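/- (Lemma 4.2) Assume (h1), (h2), (h3) and let f satisfy (f1)–(f4). If {u_n} is a sequence in M with sup_n ‖u_n‖ < ∞ which converges weakly in X to u ∈ X, then u⁺ ≠ 0 and u⁻ ≠ 0 (i.e. neither the positive nor the negative part of the weak limit vanishes a.e.). -/

import Mathlib

open MeasureTheory Filter

noncomputable section

namespace ZeroMass

/-- The ambient Euclidean space `ℝ^N`. -/
abbrev EN (N : ℕ) := EuclideanSpace ℝ (Fin N)

/-- The critical fractional Sobolev exponent `2*_α = 2N/(N-2α)`. -/
def critExp (N : ℕ) (α : ℝ) : ℝ := 2 * N / (N - 2 * α)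

/-- The square of the Gagliardo seminorm `[u]²`. -/
def gagSq (N : ℕ) (α : ℝ) (u : EN N → ℝ) : ENNReal :=
  ∫⁻ p : EN N × EN N, ENNReal.ofReal ((u p.1 - u p.2) ^ 2 / ‖p.1 - p.2‖ ^ ((N : ℝ) + 2 * α))

/-- The square of the full norm `‖u‖² = [u]² + ∫ V u²`. -/
def normSq {N : ℕ} (α : ℝ) (V : EN N → ℝ) (u : EN N → ℝ) : ENNReal :=
  gagSq N α u + ∫⁻ x, ENNReal.ofReal (V x * u x ^ 2)

/-- Membership in the space `X`. -/
def memX {N : ℕ} (α : ℝ) (V : EN N → ℝ) (u : EN N → ℝ) : Prop :=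
  Measurable u ∧ normSq α V u < ⊤

/-- The norm of `X`, i.e. `‖u‖ = ([u]² + ∫ V u²)^{1/2}`. -/
def Xnorm {N : ℕ} (α : ℝ) (V : EN N → ℝ) (u : EN N → ℝ) : ℝ :=
  ((normSq α V u).toReal) ^ (1 / 2 : ℝ)

/-- The primitive `F(t) = ∫₀ᵗ f(τ) dτ`. -/
def prim (f : ℝ → ℝ) (t : ℝ) : ℝ := ∫ τ in (0 : ℝ)..t, f τ

/-- The energy functional `J`. -/
def Jfun {N : ℕ} (α : ℝ) (V K : EN N → ℝ) (f : ℝ → ℝ) (u : EN N → ℝ) : ℝ :=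
  (1 / 2) * (normSq α V u).toReal - ∫ x, K x * prim f (u x)

/-- The pairing `⟨J'(u), φ⟩`. -/
def Jd {N : ℕ} (α : ℝ) (V K : EN N → ℝ) (f : ℝ → ℝ) (u φ : EN N → ℝ) : ℝ :=
  (∫ p : EN N × EN N, (u p.1 - u p.2) * (φ p.1 - φ p.2) / ‖p.1 - p.2‖ ^ ((N : ℝ) + 2 * α))
    + (∫ x, V x * u x * φ x) - ∫ x, K x * f (u x) * φ x

/-- Positive part `u⁺ = max(u, 0)`. -/
def uplus {N : ℕ} (u : EN N → ℝ) : EN N → ℝ := fun x => max (u x) 0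

/-- Negative part `u⁻ = min(u, 0)`. -/
def uminus {N : ℕ} (u : EN N → ℝ) : EN N → ℝ := fun x => min (u x) 0

/-- `u` is not almost everywhere zero. -/
def NotAEZero {N : ℕ} (u : EN N → ℝ) : Prop :=
  ¬ (u =ᵐ[(volume : Measure (EN N))] (0 : EN N → ℝ))

/-- Hypothesis (h1): `V, K > 0` everywhere and `K` bounded. -/
def H1 {N : ℕ} (V K : EN N → ℝ) : Prop :=
  (∀ x, 0 < V x) ∧ (∀ x, 0 < K x) ∧ ∃ C : ℝ, ∀ x, K x ≤ C

/-- Hypothesis (h2): uniform vanishing of `∫_{A_n ∩ {|x| ≥ r}} K`. -/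
def H2 {N : ℕ} (K : EN N → ℝ) : Prop :=
  ∀ (A : ℕ → Set (EN N)) (R : ℝ), 0 < R → (∀ n, MeasurableSet (A n)) →
    (∀ n, volume (A n) ≤ ENNReal.ofReal R) →
    ∀ ε : ℝ, 0 < ε → ∃ r₀ : ℝ, ∀ r : ℝ, r₀ ≤ r → ∀ n,
      (∫⁻ x in A n ∩ {x : EN N | r ≤ ‖x‖}, ENNReal.ofReal (K x)) ≤ ENNReal.ofReal ε

/-- Hypothesis (h3): `K/V` is bounded. -/
def H3 {N : ℕ} (V K : EN N → ℝ) : Prop := ∃ C : ℝ, ∀ x, K x / V x ≤ C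

/-- Hypothesis (h4) with exponent `m`. -/
def H4 {N : ℕ} (α : ℝ) (V K : EN N → ℝ) (m : ℝ) : Prop :=
  2 < m ∧ m < critExp N α ∧
    Tendsto (fun x : EN N => K x / V x ^ ((critExp N α - m) / (critExp N α - 2)))
      (comap (fun x : EN N => ‖x‖) atTop) (nhds 0)

/-- Hypothesis (f1): `f(t)/|t| → 0` as `t → 0`. -/
def Cf1 (f : ℝ → ℝ) : Prop :=
  Tendsto (fun t : ℝ => f t / |t|) (nhdsWithin 0 {(0 : ℝ)}ᶜ) (nhds 0)

/-- Hypothesis (f̃1): `limsup_{t→0} f(t)/|t|^{m-1} < ∞`. -/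
def Cf1' (f : ℝ → ℝ) (m : ℝ) : Prop :=
  ∃ C : ℝ, ∀ᶠ t in nhdsWithin (0 : ℝ) {(0 : ℝ)}ᶜ, f t / |t| ^ (m - 1) ≤ C

/-- Hypothesis (f2) with exponent `p`: `f(t)/|t|^{p-1} → 0` as `|t| → ∞`. -/
def Cf2 (f : ℝ → ℝ) (p : ℝ) : Prop :=
  Tendsto (fun t : ℝ => f t / |t| ^ (p - 1)) (comap (fun t : ℝ => |t|) atTop) (nhds 0)

/-- Hypothesis (f3): `F(t)/t² → +∞` as `|t| → ∞`. -/
def Cf3 (f : ℝ → ℝ) : Prop :=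
  Tendsto (fun t : ℝ => prim f t / t ^ 2) (comap (fun t : ℝ => |t|) atTop) atTop

/-- Hypothesis (f4): `t ↦ f(t)/|t|` is strictly increasing on `ℝ \ {0}`. -/
def Cf4 (f : ℝ → ℝ) : Prop :=
  ∀ s t : ℝ, s ≠ 0 → t ≠ 0 → s < t → f s / |s| < f t / |t|

/-- Nehari manifold membership, formulated with the pairing `⟨J'(u), u⟩ = 0`. -/
def memNehari {N : ℕ} (α : ℝ) (V K : EN N → ℝ) (f : ℝ → ℝ) (u : EN N → ℝ) : Prop :=
  memX α V u ∧ NotAEZero u ∧ Jd α V K f u u = 0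

/-- Nehari manifold membership, formulated as `‖u‖² = ∫ K f(u) u`. -/
def memNehari2 {N : ℕ} (α : ℝ) (V K : EN N → ℝ) (f : ℝ → ℝ) (u : EN N → ℝ) : Prop :=
  memX α V u ∧ NotAEZero u ∧ (normSq α V u).toReal = ∫ x, K x * f (u x) * u x

/-- Nodal (sign-changing) Nehari set membership. -/
def memM {N : ℕ} (α : ℝ) (V K : EN N → ℝ) (f : ℝ → ℝ) (u : EN N → ℝ) : Prop :=
  memNehari α V K f u ∧ NotAEZero (uplus u) ∧ NotAEZero (uminus u) ∧
    Jd α V K f u (uplus u) = 0 ∧ Jd α V K f u (uminus u) = 0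

/-- Weak convergence in `X` of the sequence `u` to `w`. -/
def weakConv {N : ℕ} (α : ℝ) (V : EN N → ℝ) (u : ℕ → EN N → ℝ) (w : EN N → ℝ) : Prop :=
  ∀ v : EN N → ℝ, memX α V v →
    Tendsto (fun n =>
      (∫ p : EN N × EN N,
        ((u n p.1 - w p.1) - (u n p.2 - w p.2)) * (v p.1 - v p.2)
          / ‖p.1 - p.2‖ ^ ((N : ℝ) + 2 * α))
      + ∫ x, V x * (u n x - w x) * v x) atTop (nhds 0)

end ZeroMass

namespace ZeroMass

open scoped ENNReal Topology

/-- The inner integral `∫ |u(x) - u(y)|² / |x - y|^{N+2α} dy` of the Gagliardo seminorm. -/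
def gagDensity {N : ℕ} (α : ℝ) (u : EN N → ℝ) (x : EN N) : ℝ≥0∞ :=
  ∫⁻ y, ENNReal.ofReal ((u x - u y) ^ 2 / ‖x - y‖ ^ ((N : ℝ) + 2 * α))

/-- The mean of `u` over the ball of radius `r` about `x`. -/
def ballMean {N : ℕ} (u : EN N → ℝ) (x : EN N) (r : ℝ) : ℝ :=
  ⨍ y in Metric.ball x r, u y

lemma measurable_gagliardo_kernel {N : ℕ} {α : ℝ} {u : EN N → ℝ} (hu : Measurable u) :
    Measurable fun p : EN N × EN N =>
      (u p.1 - u p.2) ^ 2 / ‖p.1 - p.2‖ ^ ((N : ℝ) + 2 * α) := by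
  fun_prop

lemma lintegral_gagDensity {N : ℕ} {α : ℝ} {u : EN N → ℝ} (hu : Measurable u) :
    ∫⁻ x, gagDensity α u x = gagSq N α u := by
  unfold gagDensity gagSq
  rw [Measure.volume_eq_prod, lintegral_prod _
    (measurable_gagliardo_kernel hu).ennreal_ofReal.aemeasurable]

lemma measurable_gagDensity {N : ℕ} {α : ℝ} {u : EN N → ℝ} (hu : Measurable u) :
    Measurable (gagDensity α u) :=
  (measurable_gagliardo_kernel (α := α) hu).ennreal_ofReal.lintegral_prod_right'

lemma convexOn_const_sub_sq (a : ℝ) : ConvexOn ℝ Set.univ fun t : ℝ => (a - t) ^ 2 := by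
  refine ⟨convex_univ, fun x _ y _ s t hs ht hst => ?_⟩
  obtain rfl : t = 1 - s := by linarith
  simp only [smul_eq_mul]
  nlinarith [mul_nonneg (mul_nonneg hs ht) (sq_nonneg (x - y))]

lemma ofReal_sq_sub_setAverage_le {β : Type*} [MeasurableSpace β] {μ : Measure β} {S : Set β}
    (h0 : μ S ≠ 0) (hS : μ S ≠ ∞) {u : β → ℝ} (hu : IntegrableOn u S μ) (a : ℝ) :
    ENNReal.ofReal ((a - ⨍ x in S, u x ∂μ) ^ 2)
      ≤ (μ S)⁻¹ * ∫⁻ x in S, ENNReal.ofReal ((a - u x) ^ 2) ∂μ := by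
  by_cases h : ∫⁻ x in S, ENNReal.ofReal ((a - u x) ^ 2) ∂μ = ∞
  · rw [h, ENNReal.mul_top (ENNReal.inv_ne_zero.2 hS)]
    exact le_top
  have hm : AEStronglyMeasurable (fun x => (a - u x) ^ 2) (μ.restrict S) :=
    (aestronglyMeasurable_const.sub hu.aestronglyMeasurable).pow 2
  have hnn : 0 ≤ᵐ[μ.restrict S] fun x => (a - u x) ^ 2 :=
    Eventually.of_forall fun x => sq_nonneg _
  have hLp : IntegrableOn (fun x => (a - u x) ^ 2) S μ :=
    (lintegral_ofReal_ne_top_iff_integrable hm hnn).1 h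
  have key := (convexOn_const_sub_sq a).map_set_average_le (by fun_prop) isClosed_univ h0 hS
    (by simp) hu hLp
  refine (ENNReal.ofReal_le_ofReal key).trans (le_of_eq ?_)
  rw [setAverage_eq, smul_eq_mul, ENNReal.ofReal_mul (by positivity),
    ofReal_integral_eq_lintegral_ofReal hLp hnn, Measure.real,
    ENNReal.ofReal_inv_of_pos (ENNReal.toReal_pos h0 hS), ENNReal.ofReal_toReal hS]

lemma ofReal_sq_sub_le_kernel {N : ℕ} {α : ℝ} (hα : 0 < α) (u : EN N → ℝ) {x y : EN N} {D : ℝ}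
    (hD : ‖x - y‖ ≤ D) :
    ENNReal.ofReal ((u x - u y) ^ 2) ≤ ENNReal.ofReal (D ^ ((N : ℝ) + 2 * α))
      * ENNReal.ofReal ((u x - u y) ^ 2 / ‖x - y‖ ^ ((N : ℝ) + 2 * α)) := by
  have hD0 : 0 ≤ D := (norm_nonneg _).trans hD
  rw [← ENNReal.ofReal_mul (by positivity)]
  apply ENNReal.ofReal_le_ofReal
  rcases eq_or_ne x y with rfl | hxy
  · simp
  have hpos : 0 < ‖x - y‖ := norm_pos_iff.2 (sub_ne_zero.2 hxy)
  have h2 : ‖x - y‖ ^ ((N : ℝ) + 2 * α) ≤ D ^ ((N : ℝ) + 2 * α) := by gcongr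
  rw [mul_div_assoc', le_div_iff₀ (by positivity), mul_comm]
  gcongr

lemma ofReal_sq_sub_ballMean_le {N : ℕ} {α : ℝ} (hα : 0 < α) {u : EN N → ℝ}
    (hloc : ∀ x r, IntegrableOn u (Metric.ball x r)) (x : EN N) {r : ℝ} (hr : 0 < r) :
    ENNReal.ofReal ((u x - ballMean u x r) ^ 2)
      ≤ (volume (Metric.ball x r))⁻¹ * (ENNReal.ofReal (r ^ ((N : ℝ) + 2 * α))
        * gagDensity α u x) := by
  refine (ofReal_sq_sub_setAverage_le (Metric.measure_ball_pos _ _ hr).ne' measure_ball_lt_top.ne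
    (hloc x r) (u x)).trans ?_
  gcongr
  rw [gagDensity, ← lintegral_const_mul' _ _ ENNReal.ofReal_ne_top]
  refine (setLIntegral_mono' measurableSet_ball fun y hy => ?_).trans
    (setLIntegral_le_lintegral _ _)
  refine ofReal_sq_sub_le_kernel hα u ?_
  rw [← dist_eq_norm, dist_comm]
  exact (Metric.mem_ball.1 hy).le

lemma ofReal_sq_ballMean_sub_ballMean_le {N : ℕ} {α : ℝ} (hα : 0 < α) {u : EN N → ℝ}
    (hu : Measurable u) (hloc : ∀ x r, IntegrableOn u (Metric.ball x r)) (x y : EN N) {r s D : ℝ}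
    (hr : 0 < r) (hs : 0 < s) (hD : dist x y + r + s ≤ D) :
    ENNReal.ofReal ((ballMean u x r - ballMean u y s) ^ 2)
      ≤ (volume (Metric.ball x r))⁻¹ * ((volume (Metric.ball y s))⁻¹ *
        (ENNReal.ofReal (D ^ ((N : ℝ) + 2 * α)) * gagSq N α u)) := by
  have hVy : (volume (Metric.ball y s))⁻¹ ≠ ∞ :=
    ENNReal.inv_ne_top.2 (Metric.measure_ball_pos _ _ hs).ne'
  have h1 := ofReal_sq_sub_setAverage_le (Metric.measure_ball_pos volume x hr).ne'
    measure_ball_lt_top.ne (hloc x r) (ballMean u y s)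
  rw [ballMean, ← neg_sq, neg_sub]
  refine h1.trans ?_
  gcongr
  rw [← lintegral_gagDensity hu, ← lintegral_const_mul' _ _ ENNReal.ofReal_ne_top,
    ← lintegral_const_mul' _ _ hVy]
  refine (setLIntegral_mono' measurableSet_ball fun z hz => ?_).trans
    (setLIntegral_le_lintegral _ _)
  rw [← neg_sq, neg_sub]
  refine (ofReal_sq_sub_setAverage_le (Metric.measure_ball_pos _ _ hs).ne' measure_ball_lt_top.ne
    (hloc y s) (u z)).trans ?_
  gcongr
  rw [gagDensity, ← lintegral_const_mul' _ _ ENNReal.ofReal_ne_top]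
  refine (setLIntegral_mono' measurableSet_ball fun t ht => ?_).trans
    (setLIntegral_le_lintegral _ _)
  refine ofReal_sq_sub_le_kernel hα u ?_
  rw [← dist_eq_norm]
  have h1 := Metric.mem_ball.1 hz
  have h2 := Metric.mem_ball.1 ht
  have h3 := dist_triangle4 z x y t
  rw [dist_comm t y] at h2
  linarith

/-- The volume of the unit ball of `ℝ^N`. -/
def unitBallVol (N : ℕ) : ℝ := volume.real (Metric.ball (0 : EN N) 1)

lemma unitBallVol_pos (N : ℕ) : 0 < unitBallVol N :=
  ENNReal.toReal_pos (Metric.measure_ball_pos _ _ one_pos).ne' measure_ball_lt_top.ne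

lemma volume_ball_eq {N : ℕ} (x : EN N) {r : ℝ} (hr : 0 < r) :
    volume (Metric.ball x r) = ENNReal.ofReal (r ^ (N : ℝ) * unitBallVol N) := by
  rw [Measure.addHaar_ball_of_pos _ _ hr, ENNReal.ofReal_mul (by positivity), unitBallVol,
    Measure.real, ENNReal.ofReal_toReal measure_ball_lt_top.ne, finrank_euclideanSpace_fin,
    Real.rpow_natCast]

lemma sq_sub_ballMean_le {N : ℕ} {α : ℝ} (hα : 0 < α) {u : EN N → ℝ}
    (hloc : ∀ x r, IntegrableOn u (Metric.ball x r)) {x : EN N} (hx : gagDensity α u x ≠ ∞)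
    {r : ℝ} (hr : 0 < r) :
    (u x - ballMean u x r) ^ 2
      ≤ (unitBallVol N)⁻¹ * r ^ (2 * α) * (gagDensity α u x).toReal := by
  have h := ofReal_sq_sub_ballMean_le hα hloc x hr
  have hω := unitBallVol_pos N
  rw [volume_ball_eq x hr, ← ENNReal.ofReal_inv_of_pos (by positivity), ← ENNReal.ofReal_toReal hx,
    ← ENNReal.ofReal_mul (by positivity), ← ENNReal.ofReal_mul (by positivity),
    ENNReal.ofReal_le_ofReal_iff (by positivity)] at h
  refine h.trans (le_of_eq ?_)
  rw [Real.rpow_add hr]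
  have : r ^ (N : ℝ) ≠ 0 := by positivity
  field_simp
  
lemma sq_ballMean_sub_ballMean_le {N : ℕ} {α : ℝ} (hα : 0 < α) {u : EN N → ℝ}
    (hu : Measurable u) (hloc : ∀ x r, IntegrableOn u (Metric.ball x r))
    (hG : gagSq N α u ≠ ∞) (x y : EN N) {r s D : ℝ}
    (hr : 0 < r) (hs : 0 < s) (hD : dist x y + r + s ≤ D) :
    (ballMean u x r - ballMean u y s) ^ 2
      ≤ (unitBallVol N)⁻¹ ^ 2 * (r ^ (N : ℝ))⁻¹ * (s ^ (N : ℝ))⁻¹ * D ^ ((N : ℝ) + 2 * α)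
        * (gagSq N α u).toReal := by
  have h := ofReal_sq_ballMean_sub_ballMean_le hα hu hloc x y hr hs hD
  have hω := unitBallVol_pos N
  have hD0 : 0 ≤ D := by linarith [dist_nonneg (x := x) (y := y)]
  rw [volume_ball_eq x hr, volume_ball_eq y hs, ← ENNReal.ofReal_inv_of_pos (by positivity),
    ← ENNReal.ofReal_inv_of_pos (by positivity), ← ENNReal.ofReal_toReal hG,
    ← ENNReal.ofReal_mul (by positivity), ← ENNReal.ofReal_mul (by positivity),
    ← ENNReal.ofReal_mul (by positivity), ENNReal.ofReal_le_ofReal_iff (by positivity)] at h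
  refine h.trans (le_of_eq ?_)
  rw [mul_inv, mul_inv]
  ring

lemma rpow_sub_half_sq {N : ℕ} {α r : ℝ} (hr : 0 ≤ r) :
    (r ^ (α - N / 2)) ^ 2 = r ^ (2 * α - N) := by
  rw [← Real.rpow_natCast, ← Real.rpow_mul hr]
  congr 1
  push_cast
  ring

lemma sq_ballMean_sub_ballMean_le_scaled {N : ℕ} {α : ℝ} (hα : 0 < α) {u : EN N → ℝ}
    (hu : Measurable u) (hloc : ∀ x r, IntegrableOn u (Metric.ball x r))
    (hG : gagSq N α u ≠ ∞) (x y : EN N) {a b d t : ℝ}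
    (ha : 0 < a) (hb : 0 < b) (ht : 0 < t) (hD : dist x y + a * t + b * t ≤ d * t) :
    (ballMean u x (a * t) - ballMean u y (b * t)) ^ 2
      ≤ (unitBallVol N)⁻¹ ^ 2 * (a ^ (N : ℝ))⁻¹ * (b ^ (N : ℝ))⁻¹ * d ^ ((N : ℝ) + 2 * α)
        * t ^ (2 * α - N) * (gagSq N α u).toReal := by
  have hd : 0 ≤ d := by
    have : 0 ≤ d * t := le_trans (by positivity) hD
    exact nonneg_of_mul_nonneg_left this ht
  refine (sq_ballMean_sub_ballMean_le hα hu hloc hG x y (mul_pos ha ht) (mul_pos hb ht)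
    hD).trans (le_of_eq ?_)
  rw [Real.mul_rpow ha.le ht.le, Real.mul_rpow hb.le ht.le, Real.mul_rpow hd ht.le,
    Real.rpow_add ht, Real.rpow_sub ht]
  have : t ^ (N : ℝ) ≠ 0 := by positivity
  field_simp

lemma two_rpow_lt_one {N : ℕ} {α : ℝ} (hN : 2 * α < N) : (2 : ℝ) ^ (α - N / 2) < 1 :=
  Real.rpow_lt_one_of_one_lt_of_neg one_lt_two (by linarith)

lemma abs_ballMean_double_le {N : ℕ} {α : ℝ} (hα : 0 < α)
    {u : EN N → ℝ} (hu : Measurable u) (hloc : ∀ x r, IntegrableOn u (Metric.ball x r))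
    (hG : gagSq N α u ≠ ∞) (x : EN N) {r : ℝ} (hr : 0 < r) (k : ℕ) :
    dist (ballMean u x (2 ^ k * r)) (ballMean u x (2 ^ (k + 1) * r))
      ≤ √((unitBallVol N)⁻¹ ^ 2 * ((2 : ℝ) ^ (N : ℝ))⁻¹ * 3 ^ ((N : ℝ) + 2 * α)
          * r ^ (2 * α - N) * (gagSq N α u).toReal) * ((2 : ℝ) ^ (α - N / 2)) ^ k := by
  have h := sq_ballMean_sub_ballMean_le_scaled hα hu hloc hG x x (a := 1) (b := 2) (d := 3)
    (t := 2 ^ k * r) one_pos two_pos (by positivity) (by rw [dist_self]; linarith)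
  have h2 : (2 : ℝ) ^ (k + 1) * r = 2 * (2 ^ k * r) := by ring
  have h3 : (((2 : ℝ) ^ k) ^ (2 * α - N)) = (((2 : ℝ) ^ (α - N / 2)) ^ k) ^ 2 := by
    rw [← rpow_sub_half_sq (by positivity), Real.rpow_pow_comm zero_le_two]
  rw [Real.dist_eq, h2]
  rw [one_mul] at h
  refine (Real.abs_le_sqrt h).trans (le_of_eq ?_)
  rw [Real.mul_rpow (by positivity) hr.le, h3, Real.one_rpow, inv_one, mul_one]
  rw [← Real.sqrt_sq (x := ((2 : ℝ) ^ (α - N / 2)) ^ k) (by positivity), ← Real.sqrt_mul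
    (by have := unitBallVol_pos N; positivity), Real.sqrt_sq (by positivity)]
  congr 1
  ring

lemma tendsto_ballMean_sub_ballMean {N : ℕ} {α : ℝ} (hα : 0 < α) (hN : 2 * α < N)
    {u : EN N → ℝ} (hu : Measurable u) (hloc : ∀ x r, IntegrableOn u (Metric.ball x r))
    (hG : gagSq N α u ≠ ∞) (x : EN N) {r : ℝ} (hr : 0 < r) :
    Tendsto (fun k : ℕ => ballMean u x (2 ^ k * r) - ballMean u 0 (2 ^ k * 1)) atTop (𝓝 0) := by
  set B : ℝ := (unitBallVol N)⁻¹ ^ 2 * (r ^ (N : ℝ))⁻¹ * (1 ^ (N : ℝ))⁻¹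
    * (‖x‖ + r + 1) ^ ((N : ℝ) + 2 * α) * (gagSq N α u).toReal with hB
  have hB0 : 0 ≤ B := by
    have := unitBallVol_pos N
    positivity
  have hlim : Tendsto (fun k : ℕ => √B * ((2 : ℝ) ^ (α - N / 2)) ^ k) atTop (𝓝 0) := by
    simpa using (tendsto_pow_atTop_nhds_zero_of_lt_one (by positivity)
      (two_rpow_lt_one hN)).const_mul (√B)
  refine squeeze_zero_norm (fun k => ?_) hlim
  have h2k : (1 : ℝ) ≤ 2 ^ k := one_le_pow₀ one_le_two
  have h := sq_ballMean_sub_ballMean_le_scaled hα hu hloc hG x 0 (a := r) (b := 1)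
    (d := ‖x‖ + r + 1) (t := 2 ^ k) hr one_pos (by positivity) (by
      rw [dist_zero_right]
      nlinarith [norm_nonneg x])
  have h3 : (((2 : ℝ) ^ k) ^ (2 * α - N)) = (((2 : ℝ) ^ (α - N / 2)) ^ k) ^ 2 := by
    rw [← rpow_sub_half_sq (by positivity), Real.rpow_pow_comm zero_le_two]
  rw [Real.norm_eq_abs, mul_comm _ r, mul_comm _ (1 : ℝ)]
  refine (Real.abs_le_sqrt h).trans (le_of_eq ?_)
  rw [h3, ← Real.sqrt_sq (x := ((2 : ℝ) ^ (α - N / 2)) ^ k) (by positivity), ← Real.sqrt_mul hB0,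
    Real.sqrt_sq (by positivity), hB]
  congr 1
  ring

/-- A function of finite Gagliardo seminorm has a mean value `c` at infinity. -/
lemma exists_const_sq_ballMean_sub_le {N : ℕ} {α : ℝ} (hα : 0 < α) (hN : 2 * α < N) :
    ∃ C : ℝ, 0 ≤ C ∧ ∀ u : EN N → ℝ, Measurable u →
      (∀ x r, IntegrableOn u (Metric.ball x r)) → gagSq N α u ≠ ∞ → ∃ c : ℝ, ∀ x r, 0 < r →
      (ballMean u x r - c) ^ 2 ≤ C * r ^ (2 * α - N) * (gagSq N α u).toReal := by
  have hω := unitBallVol_pos N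
  have hq := two_rpow_lt_one hN
  set A : ℝ := (unitBallVol N)⁻¹ ^ 2 * ((2 : ℝ) ^ (N : ℝ))⁻¹ * 3 ^ ((N : ℝ) + 2 * α) with hA
  have hA0 : 0 ≤ A := by positivity
  set q : ℝ := (2 : ℝ) ^ (α - N / 2) with hqdef
  refine ⟨A / (1 - q) ^ 2, by positivity, fun u hu hloc hG => ?_⟩
  obtain ⟨c, hc⟩ := cauchySeq_tendsto_of_complete
    (cauchySeq_of_le_geometric _ _ hq (abs_ballMean_double_le hα hu hloc hG 0 one_pos))
  refine ⟨c, fun x r hr => ?_⟩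
  have hlim : Tendsto (fun k : ℕ => ballMean u x (2 ^ k * r)) atTop (𝓝 c) := by
    simpa using (tendsto_ballMean_sub_ballMean hα hN hu hloc hG x hr).add hc
  have h := dist_le_of_le_geometric_of_tendsto₀ _ _ hq
    (abs_ballMean_double_le hα hu hloc hG x hr) hlim
  rw [pow_zero, one_mul, Real.dist_eq] at h
  have h' := pow_le_pow_left₀ (abs_nonneg _) h 2
  rw [sq_abs, div_pow, Real.sq_sqrt (by positivity)] at h'
  refine h'.trans (le_of_eq ?_)
  ring

lemma le_mul_rpow_of_forall_scale {N : ℕ} {α : ℝ} (hα : 0 < α) (hN : 2 * α < N) {t A B d G : ℝ}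
    (hA : 0 ≤ A) (hB : 0 ≤ B) (hd : 0 ≤ d) (hG : 0 ≤ G)
    (h : ∀ r : ℝ, 0 < r → t ≤ A * r ^ (2 * α) * d + B * r ^ (2 * α - N) * G) :
    t ≤ (A + B) * (d ^ (1 - 2 * α / N) * G ^ (2 * α / N)) := by
  have hN0 : (0 : ℝ) < N := by linarith
  have hθ : 0 < 1 - 2 * α / N := by
    rw [sub_pos, div_lt_one hN0]
    exact hN
  have hθ' : 0 < 2 * α / N := by positivity
  have key : ∀ δ : ℝ, 0 < δ →
      t ≤ (A + B) * ((d + δ) ^ (1 - 2 * α / N) * (G + δ) ^ (2 * α / N)) := by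
    intro δ hδ
    have hd' : 0 < d + δ := by linarith
    have hG' : 0 < G + δ := by linarith
    set r : ℝ := ((G + δ) / (d + δ)) ^ (1 / N : ℝ) with hr
    have hr0 : 0 < r := by positivity
    have e1 : r ^ (2 * α) * (d + δ) = (d + δ) ^ (1 - 2 * α / N) * (G + δ) ^ (2 * α / N) := by
      rw [hr, ← Real.rpow_mul (by positivity), Real.div_rpow hG'.le hd'.le, Real.rpow_sub hd',
        Real.rpow_one]
      rw [show 1 / (N : ℝ) * (2 * α) = 2 * α / N by ring]
      field_simp
    have e2 : r ^ (2 * α - N) * (G + δ) = (d + δ) ^ (1 - 2 * α / N) * (G + δ) ^ (2 * α / N) := by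
      rw [← e1, Real.rpow_sub hr0]
      have : r ^ (N : ℝ) = (G + δ) / (d + δ) := by
        rw [hr, ← Real.rpow_mul (by positivity), one_div, inv_mul_cancel₀ hN0.ne', Real.rpow_one]
      rw [this]
      field_simp
    calc t ≤ A * r ^ (2 * α) * d + B * r ^ (2 * α - N) * G := h r hr0
      _ ≤ A * r ^ (2 * α) * (d + δ) + B * r ^ (2 * α - N) * (G + δ) := by
          gcongr <;> linarith
      _ = _ := by rw [mul_assoc, mul_assoc, e1, e2]; ring
  have hcont : ContinuousAt (fun δ : ℝ =>
      (A + B) * ((d + δ) ^ (1 - 2 * α / N) * (G + δ) ^ (2 * α / N))) 0 := by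
    refine continuousAt_const.mul (ContinuousAt.mul ?_ ?_)
    · exact (continuousAt_const.add continuousAt_id).rpow_const (Or.inr hθ.le)
    · exact (continuousAt_const.add continuousAt_id).rpow_const (Or.inr hθ'.le)
  have hlim := hcont.tendsto.mono_left (nhdsWithin_le_nhds (s := Set.Ioi 0))
  simp only [add_zero] at hlim
  exact ge_of_tendsto hlim (eventually_nhdsWithin_of_forall fun δ hδ => key δ hδ)

/-- Fractional Sobolev inequality modulo constants. -/
lemma exists_const_lintegral_abs_sub_rpow_le {N : ℕ} {α : ℝ} (hα : 0 < α) (hN : 2 * α < N) :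
    ∃ C : ℝ, 0 ≤ C ∧ ∀ u : EN N → ℝ, Measurable u →
      (∀ x r, IntegrableOn u (Metric.ball x r)) → gagSq N α u ≠ ∞ → ∃ c : ℝ,
      (∀ x r, 0 < r → (ballMean u x r - c) ^ 2 ≤ C * r ^ (2 * α - N) * (gagSq N α u).toReal) ∧
      ∫⁻ x, ENNReal.ofReal (|u x - c| ^ critExp N α)
        ≤ ENNReal.ofReal (C * (gagSq N α u).toReal ^ (critExp N α / 2)) := by
  obtain ⟨C, hC, hmean⟩ := exists_const_sq_ballMean_sub_le hα hN
  have hω := unitBallVol_pos N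
  have hN0 : (0 : ℝ) < N := by linarith
  have hNα : (0 : ℝ) < N - 2 * α := by linarith
  set p := critExp N α with hp
  have hp0 : 0 < p := by rw [hp, critExp]; positivity
  set A : ℝ := 2 * (unitBallVol N)⁻¹ + 2 * C with hA
  have hA0 : 0 ≤ A := by positivity
  refine ⟨max C (A ^ (p / 2)), le_max_of_le_left hC, fun u hu hloc hG => ?_⟩
  obtain ⟨c, hc⟩ := hmean u hu hloc hG
  set G := (gagSq N α u).toReal with hGdef
  have hG0 : 0 ≤ G := ENNReal.toReal_nonneg
  refine ⟨c, fun x r hr => (hc x r hr).trans (by gcongr; exact le_max_left _ _), ?_⟩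
  have hptw : ∀ x, gagDensity α u x ≠ ∞ → |u x - c| ^ p
      ≤ A ^ (p / 2) * G ^ (2 * α / N * (p / 2)) * (gagDensity α u x).toReal := by
    intro x hx
    have h1 := le_mul_rpow_of_forall_scale hα hN (t := (u x - c) ^ 2)
      (A := 2 * (unitBallVol N)⁻¹) (B := 2 * C) (d := (gagDensity α u x).toReal) (G := G)
      (by positivity) (by positivity) ENNReal.toReal_nonneg hG0 (fun r hr => by
        have h2 := sq_sub_ballMean_le hα hloc hx hr
        have h3 := hc x r hr
        nlinarith [sq_nonneg ((u x - ballMean u x r) - (ballMean u x r - c))])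
    have h2 : |u x - c| ^ p = ((u x - c) ^ 2) ^ (p / 2) := by
      rw [← sq_abs, ← Real.rpow_natCast, ← Real.rpow_mul (abs_nonneg _)]
      congr 1
      push_cast
      ring
    rw [h2]
    refine (Real.rpow_le_rpow (sq_nonneg _) h1 (by positivity)).trans (le_of_eq ?_)
    rw [Real.mul_rpow hA0 (by positivity), Real.mul_rpow (by positivity) (by positivity),
      ← Real.rpow_mul ENNReal.toReal_nonneg, ← Real.rpow_mul hG0]
    have h4 : (1 - 2 * α / N) * (p / 2) = 1 := by
      rw [hp, critExp]
      field_simp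
    rw [h4, Real.rpow_one]
    ring
  have hfin : ∀ᵐ x, gagDensity α u x < ∞ :=
    ae_lt_top (measurable_gagDensity hu) (by rwa [lintegral_gagDensity hu])
  calc ∫⁻ x, ENNReal.ofReal (|u x - c| ^ p)
      ≤ ∫⁻ x, ENNReal.ofReal (A ^ (p / 2) * G ^ (2 * α / N * (p / 2))) * gagDensity α u x := by
        refine lintegral_mono_ae (hfin.mono fun x hx => ?_)
        rw [← ENNReal.ofReal_toReal hx.ne, ← ENNReal.ofReal_mul (by positivity)]
        exact ENNReal.ofReal_le_ofReal (hptw x hx.ne)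
    _ = ENNReal.ofReal (A ^ (p / 2) * G ^ (2 * α / N * (p / 2)) * G) := by
        rw [lintegral_const_mul' _ _ ENNReal.ofReal_ne_top, lintegral_gagDensity hu,
          ← ENNReal.ofReal_toReal hG, ← ENNReal.ofReal_mul (by positivity)]
    _ ≤ _ := by
        apply ENNReal.ofReal_le_ofReal
        rw [mul_assoc]
        have : G ^ (2 * α / N * (p / 2)) * G = G ^ (p / 2) := by
          nth_rewrite 2 [← Real.rpow_one G]
          rw [← Real.rpow_add_of_nonneg hG0 (by positivity) zero_le_one]
          congr 1
          rw [hp, critExp]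
          field_simp
          ring
        rw [this]
        gcongr
        exact le_max_right _ _

/-- The inner product of `X`. -/
def pairing {N : ℕ} (α : ℝ) (V : EN N → ℝ) (u v : EN N → ℝ) : ℝ :=
  (∫ p : EN N × EN N, (u p.1 - u p.2) * (v p.1 - v p.2) / ‖p.1 - p.2‖ ^ ((N : ℝ) + 2 * α))
    + ∫ x, V x * u x * v x

section Space

variable {N : ℕ} {α : ℝ} {V : EN N → ℝ}

lemma ofReal_add_sq_div_le {a b c : ℝ} (hc : 0 ≤ c) :
    ENNReal.ofReal ((a + b) ^ 2 / c)
      ≤ 2 * ENNReal.ofReal (a ^ 2 / c) + 2 * ENNReal.ofReal (b ^ 2 / c) := by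
  have h2 : (2 : ℝ≥0∞) = ENNReal.ofReal 2 := by simp
  rw [h2, ← ENNReal.ofReal_mul zero_le_two, ← ENNReal.ofReal_mul zero_le_two,
    ← ENNReal.ofReal_add (by positivity) (by positivity)]
  apply ENNReal.ofReal_le_ofReal
  rw [← mul_div_assoc, ← mul_div_assoc, ← add_div]
  gcongr
  nlinarith [sq_nonneg (a - b)]

lemma ofReal_mul_add_sq_le {a b c : ℝ} (hc : 0 ≤ c) :
    ENNReal.ofReal (c * (a + b) ^ 2)
      ≤ 2 * ENNReal.ofReal (c * a ^ 2) + 2 * ENNReal.ofReal (c * b ^ 2) := by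
  have := ofReal_add_sq_div_le (a := a) (b := b) (inv_nonneg.2 hc)
  simpa only [div_inv_eq_mul, mul_comm] using this

lemma normSq_add_le (hV : Continuous V) (hpos : ∀ x, 0 < V x) {u v : EN N → ℝ}
    (hu : Measurable u) :
    normSq α V (u + v) ≤ 2 * normSq α V u + 2 * normSq α V v := by
  have hVm := hV.measurable
  have h1 : gagSq N α (u + v) ≤ 2 * gagSq N α u + 2 * gagSq N α v := by
    unfold gagSq
    rw [← lintegral_const_mul' _ _ ENNReal.ofNat_ne_top,
      ← lintegral_const_mul' _ _ ENNReal.ofNat_ne_top,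
      ← lintegral_add_left ((measurable_gagliardo_kernel hu).ennreal_ofReal.const_mul 2)]
    refine lintegral_mono fun p => ?_
    have := ofReal_add_sq_div_le (a := u p.1 - u p.2) (b := v p.1 - v p.2)
      (c := ‖p.1 - p.2‖ ^ ((N : ℝ) + 2 * α)) (by positivity)
    rwa [show (u p.1 - u p.2) + (v p.1 - v p.2) = (u + v) p.1 - (u + v) p.2 by
      simp only [Pi.add_apply]; ring] at this
  have h2 : ∫⁻ x, ENNReal.ofReal (V x * (u + v) x ^ 2)
      ≤ 2 * (∫⁻ x, ENNReal.ofReal (V x * u x ^ 2))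
        + 2 * ∫⁻ x, ENNReal.ofReal (V x * v x ^ 2) := by
    rw [← lintegral_const_mul' _ _ ENNReal.ofNat_ne_top,
      ← lintegral_const_mul' _ _ ENNReal.ofNat_ne_top,
      ← lintegral_add_left (by fun_prop)]
    exact lintegral_mono fun x => ofReal_mul_add_sq_le (hpos x).le
  unfold normSq
  refine (add_le_add h1 h2).trans (le_of_eq ?_)
  ring

lemma normSq_smul (c : ℝ) (u : EN N → ℝ) :
    normSq α V (c • u) = ENNReal.ofReal (c ^ 2) * normSq α V u := by
  unfold normSq gagSq
  rw [mul_add, ← lintegral_const_mul' _ _ ENNReal.ofReal_ne_top,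
    ← lintegral_const_mul' _ _ ENNReal.ofReal_ne_top]
  congr 1
  · refine lintegral_congr fun p => ?_
    rw [← ENNReal.ofReal_mul (sq_nonneg c)]
    congr 1
    simp only [Pi.smul_apply, smul_eq_mul]
    ring
  · refine lintegral_congr fun p => ?_
    rw [← ENNReal.ofReal_mul (sq_nonneg c)]
    congr 1
    simp only [Pi.smul_apply, smul_eq_mul]
    ring

/-- The space `X` as a submodule of the space of functions. -/
def spaceX (α : ℝ) (hV : Continuous V) (hpos : ∀ x, 0 < V x) : Submodule ℝ (EN N → ℝ) where
  carrier := {u | memX α V u}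
  zero_mem' := ⟨measurable_zero, by simp [normSq, gagSq]⟩
  add_mem' {u v} hu hv := ⟨hu.1.add hv.1, (normSq_add_le hV hpos hu.1).trans_lt
    (ENNReal.add_lt_top.2 ⟨ENNReal.mul_lt_top ENNReal.ofNat_lt_top hu.2,
      ENNReal.mul_lt_top ENNReal.ofNat_lt_top hv.2⟩)⟩
  smul_mem' c u hu := ⟨hu.1.const_smul c, by
    rw [normSq_smul]
    exact ENNReal.mul_lt_top ENNReal.ofReal_lt_top hu.2⟩

lemma integrable_gag_sq {u : EN N → ℝ} (hu : memX α V u) :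
    Integrable fun p : EN N × EN N =>
      (u p.1 - u p.2) ^ 2 / ‖p.1 - p.2‖ ^ ((N : ℝ) + 2 * α) := by
  refine (lintegral_ofReal_ne_top_iff_integrable
    (measurable_gagliardo_kernel hu.1).aestronglyMeasurable
    (Eventually.of_forall fun p => by positivity)).1 ?_
  exact (lt_of_le_of_lt le_self_add hu.2).ne

lemma integrable_potential_sq (hV : Continuous V) (hpos : ∀ x, 0 < V x) {u : EN N → ℝ}
    (hu : memX α V u) : Integrable fun x => V x * u x ^ 2 := by
  have hVm := hV.measurable
  have hum := hu.1
  refine (lintegral_ofReal_ne_top_iff_integrable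
    (Measurable.aestronglyMeasurable (by fun_prop))
    (Eventually.of_forall fun x => mul_nonneg (hpos x).le (sq_nonneg _))).1 ?_
  exact (lt_of_le_of_lt le_add_self hu.2).ne

lemma integrable_gag_mul {u v : EN N → ℝ} (hu : memX α V u) (hv : memX α V v) :
    Integrable fun p : EN N × EN N =>
      (u p.1 - u p.2) * (v p.1 - v p.2) / ‖p.1 - p.2‖ ^ ((N : ℝ) + 2 * α) := by
  have hum := hu.1
  have hvm := hv.1
  refine ((integrable_gag_sq hu).add (integrable_gag_sq hv)).mono'
    (Measurable.aestronglyMeasurable (by fun_prop)) (Eventually.of_forall fun p => ?_)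
  rw [Real.norm_eq_abs, abs_div, abs_of_nonneg (a := ‖p.1 - p.2‖ ^ _) (by positivity),
    Pi.add_apply, ← add_div]
  gcongr
  rw [abs_le]
  constructor <;>
    nlinarith [sq_nonneg ((u p.1 - u p.2) + (v p.1 - v p.2)),
      sq_nonneg ((u p.1 - u p.2) - (v p.1 - v p.2))]

lemma integrable_potential_mul (hV : Continuous V) (hpos : ∀ x, 0 < V x) {u v : EN N → ℝ}
    (hu : memX α V u) (hv : memX α V v) : Integrable fun x => V x * u x * v x := by
  have hum := hu.1
  have hvm := hv.1
  have hVm := hV.measurable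
  refine ((integrable_potential_sq hV hpos hu).add (integrable_potential_sq hV hpos hv)).mono'
    (Measurable.aestronglyMeasurable (by fun_prop)) (Eventually.of_forall fun x => ?_)
  rw [Real.norm_eq_abs, mul_assoc, abs_mul, abs_of_pos (hpos x), Pi.add_apply, ← mul_add]
  refine mul_le_mul_of_nonneg_left ?_ (hpos x).le
  rw [abs_le]
  constructor <;> nlinarith [sq_nonneg (u x + v x), sq_nonneg (u x - v x)]

lemma pairing_comm (u v : EN N → ℝ) : pairing α V u v = pairing α V v u := by
  unfold pairing
  congr 1
  · exact integral_congr_ae (Eventually.of_forall fun p => by simp only [mul_comm])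
  · exact integral_congr_ae (Eventually.of_forall fun p => by simp only; ring)

lemma pairing_add_left (hV : Continuous V) (hpos : ∀ x, 0 < V x) {u v w : EN N → ℝ}
    (hu : memX α V u) (hv : memX α V v) (hw : memX α V w) :
    pairing α V (u + v) w = pairing α V u w + pairing α V v w := by
  unfold pairing
  rw [add_add_add_comm, ← integral_add (integrable_gag_mul hu hw) (integrable_gag_mul hv hw),
    ← integral_add (integrable_potential_mul hV hpos hu hw)
      (integrable_potential_mul hV hpos hv hw)]
  congr 1 <;> refine integral_congr_ae (Eventually.of_forall fun p => ?_) <;>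
    simp only [Pi.add_apply] <;> ring

lemma pairing_smul_left (c : ℝ) (u v : EN N → ℝ) :
    pairing α V (c • u) v = c * pairing α V u v := by
  unfold pairing
  rw [mul_add, ← integral_const_mul, ← integral_const_mul]
  congr 1 <;> refine integral_congr_ae (Eventually.of_forall fun p => ?_) <;>
    simp only [Pi.smul_apply, smul_eq_mul] <;> ring

lemma pairing_self (hV : Continuous V) (hpos : ∀ x, 0 < V x) {u : EN N → ℝ} (hu : memX α V u) :
    pairing α V u u = (normSq α V u).toReal := by
  have h := ENNReal.add_ne_top.1 hu.2.ne
  rw [normSq, ENNReal.toReal_add h.1 h.2, gagSq,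
    ← integral_eq_lintegral_of_nonneg_ae (Eventually.of_forall fun p => by positivity)
      (integrable_gag_sq hu).aestronglyMeasurable,
    ← integral_eq_lintegral_of_nonneg_ae (Eventually.of_forall fun x =>
      mul_nonneg (hpos x).le (sq_nonneg _))
      (integrable_potential_sq hV hpos hu).aestronglyMeasurable]
  simp only [pairing, sq, mul_assoc]

/-- The inner product of `X` as a bilinear form. -/
def pairingForm (α : ℝ) (hV : Continuous V) (hpos : ∀ x, 0 < V x) :
    LinearMap.BilinForm ℝ (spaceX α hV hpos) :=
  LinearMap.mk₂ ℝ (fun u v => pairing α V u v)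
    (fun u v w => pairing_add_left hV hpos u.2 v.2 w.2)
    (fun c u v => by rw [Submodule.coe_smul, pairing_smul_left, smul_eq_mul])
    (fun u v w => by
      rw [pairing_comm, Submodule.coe_add, pairing_add_left hV hpos v.2 w.2 u.2,
        pairing_comm, pairing_comm (w : EN N → ℝ)])
    (fun c u v => by
      rw [pairing_comm, Submodule.coe_smul, pairing_smul_left, pairing_comm, smul_eq_mul])

lemma exists_setLIntegral_sq_le (α : ℝ) (hV : Continuous V) (hpos : ∀ x, 0 < V x) (x : EN N)
    (r : ℝ) : ∃ C : ℝ, 0 < C ∧ ∀ u : EN N → ℝ,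
      ∫⁻ y in Metric.ball x r, ENNReal.ofReal (u y ^ 2) ≤ ENNReal.ofReal C * normSq α V u := by
  obtain ⟨m, hm, hle⟩ := (isCompact_closedBall x r).exists_forall_le' hV.continuousOn
    (a := 0) (fun y _ => hpos y)
  refine ⟨m⁻¹, by positivity, fun u => ?_⟩
  calc ∫⁻ y in Metric.ball x r, ENNReal.ofReal (u y ^ 2)
      ≤ ∫⁻ y in Metric.ball x r, ENNReal.ofReal m⁻¹ * ENNReal.ofReal (V y * u y ^ 2) := by
        refine setLIntegral_mono' measurableSet_ball fun y hy => ?_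
        rw [← ENNReal.ofReal_mul (by positivity)]
        apply ENNReal.ofReal_le_ofReal
        rw [← mul_assoc]
        refine le_mul_of_one_le_left (sq_nonneg _) ?_
        rw [inv_mul_eq_div, one_le_div hm]
        exact hle y (Metric.ball_subset_closedBall hy)
    _ ≤ ∫⁻ y, ENNReal.ofReal m⁻¹ * ENNReal.ofReal (V y * u y ^ 2) := setLIntegral_le_lintegral _ _
    _ ≤ _ := by
        rw [lintegral_const_mul' _ _ ENNReal.ofReal_ne_top]
        gcongr
        exact le_add_self

lemma memX.integrableOn_ball (hV : Continuous V) (hpos : ∀ x, 0 < V x) {u : EN N → ℝ}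
    (hu : memX α V u) (x : EN N) (r : ℝ) : IntegrableOn u (Metric.ball x r) := by
  obtain ⟨C, -, hC⟩ := exists_setLIntegral_sq_le α hV hpos x r
  have hsq : IntegrableOn (fun y => u y ^ 2) (Metric.ball x r) :=
    (lintegral_ofReal_ne_top_iff_integrable (hu.1.pow_const 2).aestronglyMeasurable
      (Eventually.of_forall fun y => sq_nonneg _)).1
      ((hC u).trans_lt (ENNReal.mul_lt_top ENNReal.ofReal_lt_top hu.2)).ne
  have h1 : IntegrableOn (fun _ : EN N => (1 : ℝ)) (Metric.ball x r) :=
    integrableOn_const measure_ball_lt_top.ne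
  refine (h1.add hsq).mono' hu.1.aestronglyMeasurable (Eventually.of_forall fun y => ?_)
  simp only [Pi.add_apply, Real.norm_eq_abs]
  nlinarith [sq_nonneg (|u y| - 1), sq_abs (u y), abs_nonneg (u y)]

lemma exists_sq_ballMean_le (α : ℝ) (hV : Continuous V) (hpos : ∀ x, 0 < V x) (x : EN N) {r : ℝ}
    (hr : 0 < r) : ∃ C : ℝ, 0 < C ∧ ∀ u : EN N → ℝ, memX α V u →
      ballMean u x r ^ 2 ≤ C * (normSq α V u).toReal := by
  obtain ⟨C, hC0, hC⟩ := exists_setLIntegral_sq_le α hV hpos x r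
  have hpos' := Metric.measure_ball_pos (volume : Measure (EN N)) x hr
  refine ⟨(volume.real (Metric.ball x r))⁻¹ * C, mul_pos (inv_pos.2 (ENNReal.toReal_pos
    hpos'.ne' measure_ball_lt_top.ne)) hC0, fun u hu => ?_⟩
  have h := ofReal_sq_sub_setAverage_le hpos'.ne' measure_ball_lt_top.ne
    (hu.integrableOn_ball hV hpos x r) 0
  simp only [zero_sub, neg_sq] at h
  have h2 := h.trans (mul_le_mul_right (hC u) _)
  have hfin : (volume (Metric.ball x r))⁻¹ * (ENNReal.ofReal C * normSq α V u) ≠ ∞ :=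
    (ENNReal.mul_lt_top (ENNReal.inv_lt_top.2 hpos')
      (ENNReal.mul_lt_top ENNReal.ofReal_lt_top hu.2)).ne
  have h3 := (ENNReal.ofReal_le_iff_le_toReal hfin).1 h2
  rw [ENNReal.toReal_mul, ENNReal.toReal_mul, ENNReal.toReal_inv,
    ENNReal.toReal_ofReal hC0.le, ← mul_assoc] at h3
  exact h3

end Space

/-- In a pre-Hilbert space, a bounded sequence converging weakly to zero is annihilated in the
limit by every bounded functional, completeness not being required. -/
lemma tendsto_functional_of_weak {M : Type*} [AddCommGroup M] [Module ℝ M]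
    (B : LinearMap.BilinForm ℝ M) (hsymm : ∀ x y, B x y = B y x)
    (l : M →ₗ[ℝ] ℝ) {C R : ℝ} (hC : 0 < C) (hl : ∀ x, l x ^ 2 ≤ C * B x x) {z : ℕ → M}
    (hR : ∀ n, B (z n) (z n) ≤ R) (hz : ∀ v, Tendsto (fun n => B (z n) v) atTop (𝓝 0)) :
    Tendsto (fun n => l (z n)) atTop (𝓝 0) := by
  set φ : M → ℝ := fun v => B v v - 2 * l v with hφ
  have hbdd : BddBelow (Set.range φ) := by
    refine ⟨-C, ?_⟩
    rintro _ ⟨v, rfl⟩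
    have h1 := hl v
    have h2 : l v ^ 2 / C ≤ B v v := by
      rw [div_le_iff₀ hC]
      linarith
    have h3 : 0 ≤ (l v - C) ^ 2 / C := by positivity
    have h4 : (l v - C) ^ 2 / C = l v ^ 2 / C - 2 * l v + C := by
      field_simp
      ring
    simp only [hφ]
    linarith
  set S : ℝ := |R| + 1 with hS
  have hS0 : 0 < S := by positivity
  have hRS : ∀ n, B (z n) (z n) ≤ S := fun n => (hR n).trans (by linarith [le_abs_self R])
  have happ : ∀ δ : ℝ, 0 < δ → ∃ v, ∀ n, (B (z n) v - l (z n)) ^ 2 ≤ δ * S := by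
    intro δ hδ
    obtain ⟨_, ⟨v, rfl⟩, hv⟩ := exists_lt_of_csInf_lt (Set.range_nonempty φ)
      (lt_add_of_pos_right (sInf (Set.range φ)) hδ)
    refine ⟨v, fun n => ?_⟩
    set x := z n
    set D := B x v - l x with hD
    have h1 : sInf (Set.range φ) ≤ φ (v + (-(D / S)) • x) := csInf_le hbdd ⟨_, rfl⟩
    have h2 : φ (v + (-(D / S)) • x) = φ v - 2 * (D / S) * D + (D / S) ^ 2 * B x x := by
      simp only [hφ, map_add, map_smul, LinearMap.add_apply, LinearMap.smul_apply, smul_eq_mul]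
      rw [hD, hsymm v x]
      ring
    have h3 : (D / S) ^ 2 * B x x ≤ (D / S) ^ 2 * S := by
      gcongr
      exact hRS n
    have h4 : (D / S) ^ 2 * S = D ^ 2 / S := by field_simp
    have h5 : 2 * (D / S) * D = 2 * (D ^ 2 / S) := by ring
    have h6 : D ^ 2 / S ≤ δ := by linarith
    rwa [div_le_iff₀ hS0] at h6
  rw [Metric.tendsto_atTop]
  intro ε hε
  obtain ⟨v, hv⟩ := happ ((ε / 2) ^ 2 / S) (by positivity)
  obtain ⟨n₀, hn₀⟩ := Metric.tendsto_atTop.1 (hz v) (ε / 2) (half_pos hε)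
  refine ⟨n₀, fun n hn => ?_⟩
  have h1 := hn₀ n hn
  have h2 := hv n
  rw [div_mul_cancel₀ _ hS0.ne'] at h2
  have h3 := abs_le_of_sq_le_sq h2 (half_pos hε).le
  rw [Real.dist_eq, sub_zero] at h1 ⊢
  have h4 := abs_sub_abs_le_abs_sub (l (z n)) (B (z n) v)
  rw [abs_sub_comm] at h4
  linarith

section Weighted

variable {N : ℕ} {α : ℝ} {V K : EN N → ℝ}

lemma two_lt_critExp (hα : 0 < α) (hN : 2 * α < N) : 2 < critExp N α := by
  rw [critExp, lt_div_iff₀ (by linarith)]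
  linarith

lemma memX.gagSq_ne_top {u : EN N → ℝ} (hu : memX α V u) : gagSq N α u ≠ ∞ :=
  (lt_of_le_of_lt le_self_add hu.2).ne

lemma memX.gagSq_toReal_le {u : EN N → ℝ} (hu : memX α V u) :
    (gagSq N α u).toReal ≤ (normSq α V u).toReal :=
  ENNReal.toReal_mono hu.2.ne le_self_add

/-- Every `u ∈ X` differs from a constant `c`, controlled by `‖u‖`, by a function which is
controlled in `L^{2*}`. -/
lemma exists_const_of_memX (hα : 0 < α) (hN : 2 * α < N) (hV : Continuous V)
    (hpos : ∀ x, 0 < V x) :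
    ∃ C : ℝ, 0 ≤ C ∧ ∀ u : EN N → ℝ, memX α V u → ∃ c : ℝ,
      c ^ 2 ≤ C * (normSq α V u).toReal ∧
      ∫⁻ x, ENNReal.ofReal (|u x - c| ^ critExp N α)
        ≤ ENNReal.ofReal (C * (normSq α V u).toReal ^ (critExp N α / 2)) := by
  obtain ⟨C₁, hC₁, hS⟩ := exists_const_lintegral_abs_sub_rpow_le hα hN
  obtain ⟨C₂, hC₂, hM⟩ := exists_sq_ballMean_le α hV hpos (0 : EN N) one_pos
  have hp := two_lt_critExp hα hN
  refine ⟨2 * C₁ + 2 * C₂, by positivity, fun u hu => ?_⟩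
  obtain ⟨c, hc, hLp⟩ := hS u hu.1 (hu.integrableOn_ball hV hpos) hu.gagSq_ne_top
  have hG := hu.gagSq_toReal_le
  refine ⟨c, ?_, hLp.trans (ENNReal.ofReal_le_ofReal ?_)⟩
  · have h1 := hc 0 1 one_pos
    rw [Real.one_rpow, mul_one] at h1
    have h2 := hM u hu
    have h3 := mul_le_mul_of_nonneg_left hG hC₁
    nlinarith [sq_nonneg ((ballMean u 0 1 - c) + ballMean u 0 1)]
  · have : C₁ ≤ 2 * C₁ + 2 * C₂ := by linarith
    gcongr

lemma lintegral_weight_sq_le {C : ℝ} (hC : 0 ≤ C) (hpos : ∀ x, 0 < V x)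
    (hKV : ∀ x, K x / V x ≤ C) (u : EN N → ℝ) :
    ∫⁻ x, ENNReal.ofReal (K x * u x ^ 2) ≤ ENNReal.ofReal C * normSq α V u := by
  calc ∫⁻ x, ENNReal.ofReal (K x * u x ^ 2)
      ≤ ∫⁻ x, ENNReal.ofReal C * ENNReal.ofReal (V x * u x ^ 2) := by
        refine lintegral_mono fun x => ?_
        rw [← ENNReal.ofReal_mul hC, ← mul_assoc]
        apply ENNReal.ofReal_le_ofReal
        gcongr
        exact (div_le_iff₀ (hpos x)).1 (hKV x)
    _ ≤ _ := by
        rw [lintegral_const_mul' _ _ ENNReal.ofReal_ne_top]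
        gcongr
        exact le_add_self

/-- If `X` contains a function with nonzero mean value at infinity, then `K` is integrable. -/
lemma lintegral_weight_lt_top (hp : 0 < critExp N α) {C₁ C₂ : ℝ} (hC₁ : 0 ≤ C₁) (hC₂ : 0 ≤ C₂)
    (hpos : ∀ x, 0 < V x) (hK : ∀ x, K x ≤ C₁) (hKV : ∀ x, K x / V x ≤ C₂) {u : EN N → ℝ}
    (hu : memX α V u) {c : ℝ} (hc : c ≠ 0)
    (hLp : ∫⁻ x, ENNReal.ofReal (|u x - c| ^ critExp N α) < ∞) :
    ∫⁻ x, ENNReal.ofReal (K x) < ∞ := by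
  set p := critExp N α
  have hc' : 0 < |c| / 2 := by positivity
  have hum := hu.1
  have hb : ∀ x, ENNReal.ofReal (K x)
      ≤ ENNReal.ofReal (C₁ * ((|c| / 2) ^ p)⁻¹) * ENNReal.ofReal (|u x - c| ^ p)
        + ENNReal.ofReal (C₂ * ((|c| / 2) ^ 2)⁻¹) * ENNReal.ofReal (V x * u x ^ 2) := by
    intro x
    have hV0 := (hpos x).le
    rw [← ENNReal.ofReal_mul (by positivity), ← ENNReal.ofReal_mul (by positivity),
      ← ENNReal.ofReal_add (by positivity) (by positivity)]
    apply ENNReal.ofReal_le_ofReal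
    rcases le_total (|c| / 2) |u x - c| with h | h
    · refine le_add_of_le_of_nonneg ?_ (by positivity)
      have h1 : (|c| / 2) ^ p ≤ |u x - c| ^ p := by gcongr
      calc K x ≤ C₁ * 1 := by rw [mul_one]; exact hK x
        _ ≤ C₁ * (((|c| / 2) ^ p)⁻¹ * |u x - c| ^ p) := by
            gcongr
            rwa [inv_mul_eq_div, one_le_div (by positivity)]
        _ = _ := by ring
    · refine le_add_of_nonneg_of_le (by positivity) ?_
      have h0 : |c| / 2 ≤ |u x| := by
        have := abs_sub_abs_le_abs_sub c (u x)
        rw [abs_sub_comm] at this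
        linarith
      have h1 : (|c| / 2) ^ 2 ≤ u x ^ 2 := by
        rw [← sq_abs (u x)]
        gcongr
      calc K x ≤ C₂ * V x * 1 := by rw [mul_one]; exact (div_le_iff₀ (hpos x)).1 (hKV x)
        _ ≤ C₂ * V x * (((|c| / 2) ^ 2)⁻¹ * u x ^ 2) := by
            gcongr
            rwa [inv_mul_eq_div, one_le_div (by positivity)]
        _ = _ := by ring
  refine (lintegral_mono hb).trans_lt ?_
  rw [lintegral_add_left (by fun_prop), lintegral_const_mul' _ _ ENNReal.ofReal_ne_top,
    lintegral_const_mul' _ _ ENNReal.ofReal_ne_top]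
  exact ENNReal.add_lt_top.2 ⟨ENNReal.mul_lt_top ENNReal.ofReal_lt_top hLp,
    ENNReal.mul_lt_top ENNReal.ofReal_lt_top (lt_of_le_of_lt le_add_self hu.2)⟩

lemma abs_rpow_le_two_rpow_mul {a b p : ℝ} (hp : 0 ≤ p) :
    |a| ^ p ≤ 2 ^ p * (|a - b| ^ p + |b| ^ p) := by
  have h : |a| ≤ |a - b| + |b| := by
    have := abs_sub_abs_le_abs_sub a b
    linarith
  rcases le_total |a - b| |b| with h1 | h1
  · calc |a| ^ p ≤ (2 * |b|) ^ p := by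
          gcongr
          linarith
      _ = 2 ^ p * |b| ^ p := Real.mul_rpow zero_le_two (abs_nonneg _)
      _ ≤ _ := by
          gcongr
          exact le_add_of_nonneg_left (by positivity)
  · calc |a| ^ p ≤ (2 * |a - b|) ^ p := by
          gcongr
          linarith
      _ = 2 ^ p * |a - b| ^ p := Real.mul_rpow zero_le_two (abs_nonneg _)
      _ ≤ _ := by
          gcongr
          exact le_add_of_nonneg_right (by positivity)

/-- The weighted critical embedding `X ⊂ L^{2*}(K dx)`. -/
lemma exists_lintegral_weight_rpow_le (hα : 0 < α) (hN : 2 * α < N) (hV : Continuous V)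
    (hK : Continuous K) (h1 : H1 V K) (h3 : H3 V K) :
    ∃ C : ℝ, 0 ≤ C ∧ ∀ u : EN N → ℝ, memX α V u →
      ∫⁻ x, ENNReal.ofReal (K x * |u x| ^ critExp N α)
        ≤ ENNReal.ofReal (C * (normSq α V u).toReal ^ (critExp N α / 2)) := by
  obtain ⟨hVpos, hKpos, C₁, hC₁⟩ := h1
  obtain ⟨C₂, hC₂⟩ := h3
  have hC₁0 : 0 ≤ C₁ := (hKpos 0).le.trans (hC₁ 0)
  have hC₂0 : 0 ≤ C₂ := (div_pos (hKpos 0) (hVpos 0)).le.trans (hC₂ 0)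
  have hp2 := two_lt_critExp hα hN
  set p := critExp N α with hpdef
  have hp : 0 < p := by linarith
  obtain ⟨C, hC, hS⟩ := exists_const_of_memX hα hN hV hVpos
  set k := (∫⁻ x, ENNReal.ofReal (K x)).toReal with hk
  refine ⟨2 ^ p * C₁ * C + 2 ^ p * C ^ (p / 2) * k, by positivity, fun u hu => ?_⟩
  obtain ⟨c, hc, hLp⟩ := hS u hu
  have hum := hu.1
  have hKm := hK.measurable
  set a := (normSq α V u).toReal with ha
  have ha0 : 0 ≤ a := ENNReal.toReal_nonneg
  have hcp : |c| ^ p ≤ C ^ (p / 2) * a ^ (p / 2) := by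
    rw [← Real.mul_rpow hC ha0]
    have h2 : |c| ^ p = (c ^ 2) ^ (p / 2) := by
      rw [← sq_abs, ← Real.rpow_natCast, ← Real.rpow_mul (abs_nonneg _)]
      congr 1
      push_cast
      ring
    rw [h2]
    gcongr
  have hb : ∀ x, ENNReal.ofReal (K x * |u x| ^ p)
      ≤ ENNReal.ofReal (2 ^ p * C₁) * ENNReal.ofReal (|u x - c| ^ p)
        + ENNReal.ofReal (2 ^ p * |c| ^ p) * ENNReal.ofReal (K x) := by
    intro x
    have hK0 := (hKpos x).le
    rw [← ENNReal.ofReal_mul (by positivity), ← ENNReal.ofReal_mul (by positivity),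
      ← ENNReal.ofReal_add (by positivity) (by positivity)]
    apply ENNReal.ofReal_le_ofReal
    calc K x * |u x| ^ p ≤ K x * (2 ^ p * (|u x - c| ^ p + |c| ^ p)) := by
          gcongr
          exact abs_rpow_le_two_rpow_mul hp.le
      _ = 2 ^ p * K x * |u x - c| ^ p + 2 ^ p * |c| ^ p * K x := by ring
      _ ≤ _ := by
          gcongr
          exact hC₁ x
  have hlast : ENNReal.ofReal (2 ^ p * |c| ^ p) * ∫⁻ x, ENNReal.ofReal (K x)
      ≤ ENNReal.ofReal (2 ^ p * (C ^ (p / 2) * a ^ (p / 2)) * k) := by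
    rcases eq_or_ne c 0 with rfl | hc0
    · simp [hp.ne']
    · have hfin := lintegral_weight_lt_top hp hC₁0 hC₂0 hVpos hC₁ hC₂ hu hc0
        (hLp.trans_lt ENNReal.ofReal_lt_top)
      rw [ENNReal.ofReal_mul (q := k) (by positivity), hk, ENNReal.ofReal_toReal hfin.ne]
      gcongr
  calc ∫⁻ x, ENNReal.ofReal (K x * |u x| ^ p)
      ≤ ENNReal.ofReal (2 ^ p * C₁) * (∫⁻ x, ENNReal.ofReal (|u x - c| ^ p))
        + ENNReal.ofReal (2 ^ p * |c| ^ p) * ∫⁻ x, ENNReal.ofReal (K x) := by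
        refine (lintegral_mono hb).trans (le_of_eq ?_)
        rw [lintegral_add_left (by fun_prop), lintegral_const_mul' _ _ ENNReal.ofReal_ne_top,
          lintegral_const_mul' _ _ ENNReal.ofReal_ne_top]
    _ ≤ ENNReal.ofReal (2 ^ p * C₁) * ENNReal.ofReal (C * a ^ (p / 2))
        + ENNReal.ofReal (2 ^ p * (C ^ (p / 2) * a ^ (p / 2)) * k) :=
        add_le_add (mul_le_mul_right hLp _) hlast
    _ = _ := by
        rw [← ENNReal.ofReal_mul (by positivity), ← ENNReal.ofReal_add (by positivity)
          (by positivity)]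
        congr 1
        ring

lemma exists_setLIntegral_norm_ge_le {g : EN N → ℝ≥0∞} (hg : Measurable g)
    (hfin : ∫⁻ x, g x ≠ ∞) {ε : ℝ≥0∞} (hε : 0 < ε) :
    ∃ r : ℝ, ∫⁻ x in {x : EN N | r ≤ ‖x‖}, g x ≤ ε := by
  have hmeas : ∀ n : ℕ, MeasurableSet {x : EN N | (n : ℝ) ≤ ‖x‖} := fun n =>
    measurableSet_le measurable_const measurable_norm
  have hlim : Tendsto (fun n : ℕ => ∫⁻ x, {x : EN N | (n : ℝ) ≤ ‖x‖}.indicator g x) atTop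
      (𝓝 (∫⁻ _ : EN N, 0)) := by
    refine tendsto_lintegral_of_dominated_convergence g (fun n => hg.indicator (hmeas n))
      (fun n => Eventually.of_forall fun x => Set.indicator_le_self _ _ _) hfin
      (Eventually.of_forall fun x => ?_)
    refine tendsto_const_nhds.congr' ?_
    obtain ⟨n₀, hn₀⟩ := exists_nat_gt ‖x‖
    filter_upwards [eventually_ge_atTop n₀] with n hn
    rw [Set.indicator_of_notMem]
    simp only [Set.mem_ofPred_eq, not_le]
    exact hn₀.trans_le (by exact_mod_cast hn)
  rw [lintegral_zero] at hlim
  obtain ⟨n, hn⟩ := ((tendsto_order.1 hlim).2 ε hε).exists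
  rw [lintegral_indicator (hmeas n)] at hn
  exact ⟨n, hn.le⟩

/-- Uniform smallness at infinity of the `K`-measure of superlevel sets along bounded sequences. -/
lemma exists_setLIntegral_superlevel_tail_le (hα : 0 < α) (hN : 2 * α < N) (hV : Continuous V)
    (hK : Continuous K) (h1 : H1 V K) (h2 : H2 K) (h3 : H3 V K) {u : ℕ → EN N → ℝ}
    (hu : ∀ n, memX α V (u n)) {R : ℝ} (hR : ∀ n, (normSq α V (u n)).toReal ≤ R) {s ε : ℝ}
    (hs : 0 < s) (hε : 0 < ε) :
    ∃ r : ℝ, ∀ n, ∫⁻ x in {x | s ≤ |u n x|} ∩ {x : EN N | r ≤ ‖x‖}, ENNReal.ofReal (K x)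
      ≤ ENNReal.ofReal ε := by
  by_cases hKint : ∫⁻ x, ENNReal.ofReal (K x) = ∞
  · obtain ⟨hVpos, hKpos, C₁, hC₁⟩ := h1
    obtain ⟨C₂, hC₂⟩ := h3
    have hC₁0 : 0 ≤ C₁ := (hKpos 0).le.trans (hC₁ 0)
    have hC₂0 : 0 ≤ C₂ := (div_pos (hKpos 0) (hVpos 0)).le.trans (hC₂ 0)
    have hp2 := two_lt_critExp hα hN
    set p := critExp N α with hpdef
    have hp : 0 < p := by linarith
    obtain ⟨C, hC, hS⟩ := exists_const_of_memX hα hN hV hVpos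
    have hR0 : 0 ≤ R := ENNReal.toReal_nonneg.trans (hR 0)
    have hvol : ∀ n, volume {x | s ≤ |u n x|}
        ≤ ENNReal.ofReal (C * R ^ (p / 2) / s ^ p + 1) := by
      intro n
      obtain ⟨c, hc, hLp⟩ := hS (u n) (hu n)
      have hc0 : c = 0 := by
        by_contra hc0
        exact (lintegral_weight_lt_top hp hC₁0 hC₂0 hVpos hC₁ hC₂ (hu n) hc0
          (hLp.trans_lt ENNReal.ofReal_lt_top)).ne hKint
      subst hc0
      have hum := (hu n).1
      have hsp : 0 < s ^ p := by positivity
      calc volume {x | s ≤ |u n x|}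
          ≤ volume {x | ENNReal.ofReal (s ^ p) ≤ ENNReal.ofReal (|u n x - 0| ^ p)} := by
            refine measure_mono fun x hx => ENNReal.ofReal_le_ofReal ?_
            rw [sub_zero]
            exact Real.rpow_le_rpow hs.le hx hp.le
        _ ≤ (∫⁻ x, ENNReal.ofReal (|u n x - 0| ^ p)) / ENNReal.ofReal (s ^ p) :=
            meas_ge_le_lintegral_div (Measurable.aemeasurable (by fun_prop))
              (ENNReal.ofReal_pos.2 hsp).ne' ENNReal.ofReal_ne_top
        _ ≤ ENNReal.ofReal (C * (normSq α V (u n)).toReal ^ (p / 2)) / ENNReal.ofReal (s ^ p) := by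
            gcongr
        _ ≤ _ := by
            rw [← ENNReal.ofReal_div_of_pos hsp]
            apply ENNReal.ofReal_le_ofReal
            have : C * (normSq α V (u n)).toReal ^ (p / 2) / s ^ p ≤ C * R ^ (p / 2) / s ^ p := by
              gcongr
              exact hR n
            linarith
    obtain ⟨r, hr⟩ := h2 (fun n => {x | s ≤ |u n x|}) (C * R ^ (p / 2) / s ^ p + 1)
      (by positivity) (fun n => measurableSet_le measurable_const (hu n).1.abs) hvol ε hε
    exact ⟨r, fun n => hr r le_rfl n⟩
  · obtain ⟨r, hr⟩ := exists_setLIntegral_norm_ge_le hK.measurable.ennreal_ofReal hKint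
      (ENNReal.ofReal_pos.2 hε)
    exact ⟨r, fun n => (lintegral_mono_set Set.inter_subset_right).trans hr⟩

end Weighted

section LocalCompactness

variable {N : ℕ} {α : ℝ} {V : EN N → ℝ}

lemma volume_abs_sub_ballMean_ge_le (hα : 0 < α) {u : EN N → ℝ} (hu : Measurable u)
    (hloc : ∀ x r, IntegrableOn u (Metric.ball x r)) (hG : gagSq N α u ≠ ∞) {h t : ℝ}
    (hh : 0 < h) (ht : 0 < t) :
    volume {x | t ≤ |u x - ballMean u x h|}
      ≤ ENNReal.ofReal ((unitBallVol N)⁻¹ * h ^ (2 * α) * (gagSq N α u).toReal / t ^ 2) := by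
  have hω := unitBallVol_pos N
  set A : ℝ := (unitBallVol N)⁻¹ * h ^ (2 * α) with hA
  have hA0 : 0 ≤ A := by positivity
  have ht2 : 0 < t ^ 2 := by positivity
  have hsub : {x | t ≤ |u x - ballMean u x h|}
      ⊆ {x | ENNReal.ofReal (t ^ 2) ≤ ENNReal.ofReal A * gagDensity α u x} := by
    intro x hx
    refine le_trans ?_ ((ofReal_sq_sub_ballMean_le hα hloc x hh).trans (le_of_eq ?_))
    · apply ENNReal.ofReal_le_ofReal
      rw [← sq_abs (u x - _)]
      exact pow_le_pow_left₀ ht.le hx 2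
    · rw [volume_ball_eq x hh, ← ENNReal.ofReal_inv_of_pos (by positivity), ← mul_assoc,
        ← ENNReal.ofReal_mul (by positivity)]
      congr 2
      rw [Real.rpow_add hh, hA]
      have : h ^ (N : ℝ) ≠ 0 := by positivity
      field_simp
  calc volume {x | t ≤ |u x - ballMean u x h|}
      ≤ volume {x | ENNReal.ofReal (t ^ 2) ≤ ENNReal.ofReal A * gagDensity α u x} :=
        measure_mono hsub
    _ ≤ (∫⁻ x, ENNReal.ofReal A * gagDensity α u x) / ENNReal.ofReal (t ^ 2) :=
        meas_ge_le_lintegral_div ((measurable_gagDensity hu).const_mul _).aemeasurable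
          (ENNReal.ofReal_pos.2 ht2).ne' ENNReal.ofReal_ne_top
    _ = _ := by
        rw [lintegral_const_mul' _ _ ENNReal.ofReal_ne_top, lintegral_gagDensity hu,
          ENNReal.ofReal_div_of_pos ht2, ENNReal.ofReal_mul hA0, ENNReal.ofReal_toReal hG]

lemma measurable_ballMean {u : EN N → ℝ} (hu : Measurable u) {r : ℝ} (hr : 0 < r) :
    Measurable fun x => ballMean u x r := by
  have hset : MeasurableSet {p : EN N × EN N | dist p.2 p.1 < r} :=
    measurableSet_lt (by fun_prop) measurable_const
  have hF : StronglyMeasurable (Function.uncurry fun x y : EN N =>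
      {p : EN N × EN N | dist p.2 p.1 < r}.indicator (fun p => u p.2) (x, y)) :=
    ((hu.comp measurable_snd).indicator hset).stronglyMeasurable
  have h := (hF.integral_prod_right (ν := volume)).measurable.const_mul
    (r ^ (N : ℝ) * unitBallVol N)⁻¹
  convert h using 2 with x
  rw [ballMean, setAverage_eq, smul_eq_mul, Measure.real, volume_ball_eq x hr,
    ENNReal.toReal_ofReal (mul_pos (by positivity) (unitBallVol_pos N)).le,
    ← integral_indicator measurableSet_ball]
  rfl

/-- Boundedness and weak convergence to zero in `X` imply local convergence in measure. -/
lemma tendsto_volume_superlevel_inter_ball (hα : 0 < α) (hV : Continuous V)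
    (hpos : ∀ x, 0 < V x) {z : ℕ → EN N → ℝ} (hz : ∀ n, memX α V (z n)) {R : ℝ}
    (hR : ∀ n, (normSq α V (z n)).toReal ≤ R)
    (hweak : ∀ v, memX α V v → Tendsto (fun n => pairing α V (z n) v) atTop (𝓝 0)) {s : ℝ}
    (hs : 0 < s) (r : ℝ) :
    Tendsto (fun n => volume ({x | s ≤ |z n x|} ∩ Metric.ball 0 r)) atTop (𝓝 0) := by
  have hR0 : 0 ≤ R := ENNReal.toReal_nonneg.trans (hR 0)
  have hω := unitBallVol_pos N
  have hmean : ∀ x h, 0 < h → Tendsto (fun n => ballMean (z n) x h) atTop (𝓝 0) := by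
    intro x h hh
    obtain ⟨C, hC, hle⟩ := exists_sq_ballMean_le α hV hpos x hh
    let l : spaceX α hV hpos →ₗ[ℝ] ℝ :=
      { toFun := fun u => ballMean u x h
        map_add' := fun u v => by
          simp only [ballMean, setAverage_eq, Submodule.coe_add, Pi.add_apply]
          rw [integral_add (u.2.integrableOn_ball hV hpos x h)
            (v.2.integrableOn_ball hV hpos x h), smul_add]
        map_smul' := fun c u => by
          simp only [ballMean, setAverage_eq, Submodule.coe_smul, Pi.smul_apply, smul_eq_mul,
            integral_const_mul, RingHom.id_apply]
          ring }
    refine tendsto_functional_of_weak (pairingForm α hV hpos) (fun u v => pairing_comm _ _) l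
      (R := R) hC (fun u => ?_) (z := fun n => ⟨z n, hz n⟩) (fun n => ?_) (fun v => hweak v v.2)
    · exact (hle u u.2).trans_eq (congrArg _ (pairing_self hV hpos u.2).symm)
    · exact (pairing_self hV hpos (hz n)).trans_le (hR n)
  rw [ENNReal.tendsto_nhds_zero]
  intro ε hε
  obtain ⟨δ, hδ, hδε⟩ : ∃ δ : ℝ, 0 < δ ∧ ENNReal.ofReal δ ≤ ε / 2 := by
    obtain ⟨δ, hδ0, hδ⟩ := ENNReal.lt_iff_exists_nnreal_btwn.1 (ENNReal.half_pos hε.ne')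
    exact ⟨δ, by exact_mod_cast hδ0, by rw [ENNReal.ofReal_coe_nnreal]; exact hδ.le⟩
  set q : ℝ := δ * (s / 2) ^ 2 * unitBallVol N / (R + 1) with hq
  have hq0 : 0 < q := by positivity
  set h : ℝ := q ^ (1 / (2 * α)) with hh
  have hh0 : 0 < h := by positivity
  have hhq : h ^ (2 * α) = q := by
    rw [hh, ← Real.rpow_mul hq0.le, one_div, inv_mul_cancel₀ (by positivity), Real.rpow_one]
  have hA : ∀ n, volume {x | s / 2 ≤ |z n x - ballMean (z n) x h|} ≤ ε / 2 := by
    intro n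
    refine ((volume_abs_sub_ballMean_ge_le hα (hz n).1 ((hz n).integrableOn_ball hV hpos)
      (hz n).gagSq_ne_top hh0 (half_pos hs)).trans (ENNReal.ofReal_le_ofReal ?_)).trans hδε
    rw [hhq, div_le_iff₀ (by positivity)]
    calc (unitBallVol N)⁻¹ * q * (gagSq N α (z n)).toReal
        ≤ (unitBallVol N)⁻¹ * q * (R + 1) := by
          gcongr
          linarith [(hz n).gagSq_toReal_le, hR n]
      _ = δ * (s / 2) ^ 2 := by
          rw [hq]
          field_simp
  have hB : Tendsto (fun n => volume.restrict (Metric.ball (0 : EN N) r)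
      {x | ENNReal.ofReal (s / 2) ≤ edist (ballMean (z n) x h) 0}) atTop (𝓝 0) := by
    have : IsFiniteMeasure (volume.restrict (Metric.ball (0 : EN N) r)) :=
      ⟨by rw [Measure.restrict_apply_univ]; exact measure_ball_lt_top⟩
    exact tendstoInMeasure_of_tendsto_ae (g := fun _ => (0 : ℝ))
      (fun n => (measurable_ballMean (hz n).1 hh0).aestronglyMeasurable)
      (Eventually.of_forall fun x => hmean x h hh0) _ (ENNReal.ofReal_pos.2 (half_pos hs))
  filter_upwards [ENNReal.tendsto_nhds_zero.1 hB (ε / 2) (ENNReal.half_pos hε.ne')] with n hn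
  rw [Measure.restrict_apply' measurableSet_ball] at hn
  calc volume ({x | s ≤ |z n x|} ∩ Metric.ball 0 r)
      ≤ volume ({x | s / 2 ≤ |z n x - ballMean (z n) x h|} ∪
        {x | ENNReal.ofReal (s / 2) ≤ edist (ballMean (z n) x h) 0} ∩ Metric.ball 0 r) := by
        refine measure_mono fun x hx => ?_
        by_cases hx' : s / 2 ≤ |z n x - ballMean (z n) x h|
        · exact Or.inl hx'
        · refine Or.inr ⟨?_, hx.2⟩
          have h1 : s ≤ |z n x| := hx.1
          have h2 := abs_sub_abs_le_abs_sub (z n x) (ballMean (z n) x h)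
          rw [Set.mem_ofPred_eq, edist_dist, Real.dist_eq, sub_zero]
          apply ENNReal.ofReal_le_ofReal
          linarith
    _ ≤ ε / 2 + ε / 2 := (measure_union_le _ _).trans (add_le_add (hA n) hn)
    _ = ε := ENNReal.add_halves ε

end LocalCompactness

section PositivePart

variable {N : ℕ} {α : ℝ} {V K : EN N → ℝ}

lemma abs_max_zero_sub_max_zero_le (a b : ℝ) : |max a 0 - max b 0| ≤ |a - b| :=
  abs_max_sub_max_le_abs a b 0

lemma sq_max_zero_le (a : ℝ) : max a 0 ^ 2 ≤ a ^ 2 := by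
  rcases le_total a 0 with h | h
  · rw [max_eq_right h]
    simpa using sq_nonneg a
  · rw [max_eq_left h]

lemma normSq_uplus_le (hpos : ∀ x, 0 < V x) (u : EN N → ℝ) :
    normSq α V (uplus u) ≤ normSq α V u := by
  refine add_le_add (lintegral_mono fun p => ?_) (lintegral_mono fun x => ?_)
  · apply ENNReal.ofReal_le_ofReal
    gcongr ?_ / _
    exact sq_le_sq.2 (abs_max_zero_sub_max_zero_le _ _)
  · exact ENNReal.ofReal_le_ofReal (mul_le_mul_of_nonneg_left (sq_max_zero_le _) (hpos x).le)

lemma memX.uplus (hpos : ∀ x, 0 < V x) {u : EN N → ℝ} (hu : memX α V u) :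
    memX α V (uplus u) :=
  ⟨hu.1.max measurable_const, (normSq_uplus_le hpos u).trans_lt hu.2⟩

lemma normSq_toReal_pos (hpos : ∀ x, 0 < V x) (hV : Continuous V) {u : EN N → ℝ}
    (hu : memX α V u) (h0 : NotAEZero u) : 0 < (normSq α V u).toReal := by
  refine ENNReal.toReal_pos (fun h => h0 ?_) hu.2.ne
  have h2 := (add_eq_zero.1 h).2
  have hum := hu.1
  have hVm := hV.measurable
  rw [lintegral_eq_zero_iff (by fun_prop)] at h2
  filter_upwards [h2] with x hx
  have h3 := ENNReal.ofReal_eq_zero.1 hx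
  have h4 : V x * u x ^ 2 = 0 := le_antisymm h3 (mul_nonneg (hpos x).le (sq_nonneg _))
  simpa [(hpos x).ne'] using h4

/-- Testing the Nehari identity with the positive part. -/
lemma normSq_uplus_le_lintegral (hV : Continuous V) (hpos : ∀ x, 0 < V x) (hKpos : ∀ x, 0 < K x)
    {f : ℝ → ℝ} {u : EN N → ℝ} (hu : memX α V u) (hJ : Jd α V K f u (uplus u) = 0) :
    normSq α V (uplus u)
      ≤ ∫⁻ x, ENNReal.ofReal (K x * (|f (uplus u x)| * uplus u x)) := by
  have hv := hu.uplus hpos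
  have h1 : pairing α V (uplus u) (uplus u) ≤ pairing α V u (uplus u) := by
    refine add_le_add (integral_mono (integrable_gag_mul hv hv) (integrable_gag_mul hu hv)
      fun p => ?_) (integral_mono (integrable_potential_mul hV hpos hv hv)
      (integrable_potential_mul hV hpos hu hv) fun x => ?_)
    · simp only
      gcongr ?_ / _
      simp only [uplus]
      rcases le_total (u p.1) 0 with h | h <;> rcases le_total (u p.2) 0 with h' | h' <;>
        simp only [max_eq_left, max_eq_right, h, h'] <;> nlinarith
    · simp only [mul_assoc]
      refine mul_le_mul_of_nonneg_left ?_ (hpos x).le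
      simp only [uplus]
      rcases le_total (u x) 0 with h | h <;> simp [h]
  have h2 : pairing α V u (uplus u) = ∫ x, K x * f (u x) * uplus u x := sub_eq_zero.1 hJ
  rw [pairing_self hV hpos hv, h2] at h1
  calc normSq α V (uplus u) = ENNReal.ofReal (normSq α V (uplus u)).toReal :=
        (ENNReal.ofReal_toReal hv.2.ne).symm
    _ ≤ ENNReal.ofReal (∫ x, K x * f (u x) * uplus u x) := ENNReal.ofReal_le_ofReal h1
    _ ≤ ENNReal.ofReal ‖∫ x, K x * f (u x) * uplus u x‖ :=
        ENNReal.ofReal_le_ofReal (Real.le_norm_self _)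
    _ ≤ ∫⁻ x, ‖K x * f (u x) * uplus u x‖ₑ := by
        rw [ofReal_norm]
        exact enorm_integral_le_lintegral_enorm _
    _ = _ := by
        refine lintegral_congr fun x => ?_
        rw [← ofReal_norm, Real.norm_eq_abs, abs_mul, abs_mul, abs_of_pos (hKpos x),
          mul_assoc]
        congr 2
        simp only [uplus]
        rcases le_total (u x) 0 with h | h <;> simp [h, abs_of_nonneg]

end PositivePart

/-- A subcritical nonlinearity is controlled by small multiples of `t²` and `t^p` away from a
bounded set. -/
lemma exists_abs_mul_le {f : ℝ → ℝ} (hf : Continuous f) {p : ℝ} (hf1 : Cf1 f) (hf2 : Cf2 f p)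
    {ε : ℝ} (hε : 0 < ε) :
    ∃ C s : ℝ, 0 ≤ C ∧ 0 < s ∧ ∀ t, 0 ≤ t →
      |f t| * t ≤ ε * (t ^ 2 + t ^ p) + Set.indicator (Set.Ici s) (fun _ => C) t := by
  obtain ⟨s, hs, hs1⟩ : ∃ s > 0, ∀ t, 0 < t → t < s → |f t| ≤ ε * t := by
    have h := Metric.tendsto_nhdsWithin_nhds.1 hf1 ε hε
    obtain ⟨s, hs, h⟩ := h
    refine ⟨s, hs, fun t ht hts => ?_⟩
    have h1 := h (x := t) ht.ne' (by rwa [Real.dist_eq, sub_zero, abs_of_pos ht])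
    rw [Real.dist_eq, sub_zero, abs_div, abs_abs, abs_of_pos ht, div_lt_iff₀ ht] at h1
    exact h1.le
  obtain ⟨S, hS0, hS⟩ : ∃ S > 0, ∀ t, S ≤ t → |f t| ≤ ε * t ^ (p - 1) := by
    have h := (Metric.tendsto_nhds.1 hf2 ε hε)
    rw [eventually_comap] at h
    obtain ⟨S, hS⟩ := eventually_atTop.1 h
    refine ⟨max S 1, by positivity, fun t ht => ?_⟩
    have ht0 : 0 < t := lt_of_lt_of_le (by positivity) ht
    have h1 := hS t ((le_max_left _ _).trans ht) t (abs_of_pos ht0)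
    rw [Real.dist_eq, sub_zero, abs_div, abs_of_pos ht0,
      abs_of_pos (Real.rpow_pos_of_pos ht0 _), div_lt_iff₀ (Real.rpow_pos_of_pos ht0 _)] at h1
    exact h1.le
  obtain ⟨M, hM⟩ := (isCompact_Icc (a := (0 : ℝ)) (b := S)).exists_bound_of_continuousOn
    hf.continuousOn
  have hM0 : 0 ≤ M := (norm_nonneg _).trans (hM 0 ⟨le_rfl, hS0.le⟩)
  refine ⟨M * S, s, by positivity, hs, fun t ht => ?_⟩
  have hind : 0 ≤ Set.indicator (Set.Ici s) (fun _ => M * S) t :=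
    Set.indicator_nonneg (fun _ _ => by positivity) _
  have htp : 0 ≤ t ^ p := by positivity
  rcases ht.eq_or_lt with rfl | ht0
  · rw [mul_zero]
    positivity
  rcases lt_or_ge t s with h | h
  · have := mul_le_mul_of_nonneg_right (hs1 t ht0 h) ht
    nlinarith
  rcases le_total S t with h' | h'
  · have h2 := mul_le_mul_of_nonneg_right (hS t h') ht
    have h3 : t ^ (p - 1) * t = t ^ p := by
      rw [Real.rpow_sub_one ht0.ne', div_mul_cancel₀ _ ht0.ne']
    rw [mul_assoc, h3] at h2
    nlinarith [sq_nonneg t]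
  · rw [Set.indicator_of_mem (Set.mem_Ici.2 h)]
    have h2 : |f t| * t ≤ M * S := by
      have := hM t ⟨ht, h'⟩
      rw [Real.norm_eq_abs] at this
      gcongr
    have : 0 ≤ ε * (t ^ 2 + t ^ p) := by positivity
    linarith

section Energy

variable {N : ℕ} {α : ℝ} {V K : EN N → ℝ}

/-- Energy estimate for functions satisfying the Nehari inequality. -/
lemma exists_energy_le (hα : 0 < α) (hN : 2 * α < N) (hV : Continuous V)
    (hK : Continuous K) (h1 : H1 V K) (h3 : H3 V K) {f : ℝ → ℝ} (hf : Continuous f)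
    (hf1 : Cf1 f) (hf2 : Cf2 f (critExp N α)) :
    ∃ A : ℝ, 0 < A ∧ ∀ ε : ℝ, 0 < ε → ∃ C s : ℝ, 0 ≤ C ∧ 0 < s ∧
      ∀ v : EN N → ℝ, memX α V v → (∀ x, 0 ≤ v x) →
        normSq α V v ≤ ∫⁻ x, ENNReal.ofReal (K x * (|f (v x)| * v x)) →
        ∀ k : ℝ, 0 ≤ k → ∫⁻ x in {x | s ≤ |v x|}, ENNReal.ofReal (K x) ≤ ENNReal.ofReal k →
          (normSq α V v).toReal ≤ ε * (A * (normSq α V v).toReal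
            + A * (normSq α V v).toReal ^ (critExp N α / 2)) + C * k := by
  obtain ⟨B, hB, hLp⟩ := exists_lintegral_weight_rpow_le hα hN hV hK h1 h3
  obtain ⟨hVpos, hKpos, -⟩ := h1
  obtain ⟨C₂, hC₂⟩ := h3
  have hC₂0 : 0 ≤ C₂ := (div_pos (hKpos 0) (hVpos 0)).le.trans (hC₂ 0)
  set p := critExp N α with hp
  refine ⟨B + C₂ + 1, by positivity, fun ε hε => ?_⟩
  obtain ⟨C, s, hC, hs, hfle⟩ := exists_abs_mul_le hf hf1 hf2 hε
  refine ⟨C, s, hC, hs, fun v hv hv0 hle k hk hks => ?_⟩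
  have hvm := hv.1
  have hKm := hK.measurable
  set a := (normSq α V v).toReal with ha
  have ha0 : 0 ≤ a := ENNReal.toReal_nonneg
  have hset : MeasurableSet {x | s ≤ |v x|} := measurableSet_le measurable_const hvm.abs
  have hpt : ∀ x, ENNReal.ofReal (K x * (|f (v x)| * v x))
      ≤ ENNReal.ofReal ε * ENNReal.ofReal (K x * v x ^ 2)
        + ENNReal.ofReal ε * ENNReal.ofReal (K x * |v x| ^ p)
        + ENNReal.ofReal C * {x | s ≤ |v x|}.indicator (fun x => ENNReal.ofReal (K x)) x := by
    intro x
    have hK0 := (hKpos x).le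
    have h := mul_le_mul_of_nonneg_left (hfle (v x) (hv0 x)) hK0
    have hind : ENNReal.ofReal C * {x | s ≤ |v x|}.indicator (fun x => ENNReal.ofReal (K x)) x
        = ENNReal.ofReal (K x * Set.indicator (Set.Ici s) (fun _ => C) (v x)) := by
      by_cases hx : s ≤ v x
      · rw [Set.indicator_of_mem (Set.mem_Ici.2 hx), Set.indicator_of_mem
          (show x ∈ {x | s ≤ |v x|} from hx.trans (le_abs_self _)), mul_comm (K x),
          ENNReal.ofReal_mul hC]
      · rw [Set.indicator_of_notMem (show v x ∉ Set.Ici s from hx), Set.indicator_of_notMem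
          (show x ∉ {x | s ≤ |v x|} from fun h' => hx (h'.trans_eq (abs_of_nonneg (hv0 x))))]
        simp
    have hi0 : 0 ≤ Set.indicator (Set.Ici s) (fun _ => C) (v x) :=
      Set.indicator_nonneg (fun _ _ => hC) _
    rw [hind, ← ENNReal.ofReal_mul hε.le, ← ENNReal.ofReal_mul hε.le,
      ← ENNReal.ofReal_add (by positivity) (by positivity),
      ← ENNReal.ofReal_add (by positivity) (by positivity)]
    refine ENNReal.ofReal_le_ofReal (h.trans (le_of_eq ?_))
    rw [abs_of_nonneg (hv0 x)]
    ring
  have hsq : ∫⁻ x, ENNReal.ofReal (K x * v x ^ 2) ≤ ENNReal.ofReal (C₂ * a) := by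
    refine (lintegral_weight_sq_le (α := α) hC₂0 hVpos hC₂ v).trans (le_of_eq ?_)
    rw [ENNReal.ofReal_mul hC₂0, ha, ENNReal.ofReal_toReal hv.2.ne]
  have htot : normSq α V v ≤ ENNReal.ofReal ε * ENNReal.ofReal (C₂ * a)
      + ENNReal.ofReal ε * ENNReal.ofReal (B * a ^ (p / 2))
      + ENNReal.ofReal C * ENNReal.ofReal k := by
    refine hle.trans ((lintegral_mono hpt).trans ?_)
    rw [lintegral_add_left (by fun_prop), lintegral_add_left (by fun_prop),
      lintegral_const_mul' _ _ ENNReal.ofReal_ne_top,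
      lintegral_const_mul' _ _ ENNReal.ofReal_ne_top,
      lintegral_const_mul' _ _ ENNReal.ofReal_ne_top, lintegral_indicator hset]
    exact add_le_add (add_le_add (mul_le_mul_right hsq _) (mul_le_mul_right (hLp v hv) _))
      (mul_le_mul_right hks _)
  rw [← ENNReal.ofReal_mul hε.le, ← ENNReal.ofReal_mul hε.le, ← ENNReal.ofReal_mul hC,
    ← ENNReal.ofReal_add (by positivity) (by positivity),
    ← ENNReal.ofReal_add (by positivity) (by positivity)] at htot
  refine (ENNReal.toReal_le_of_le_ofReal (by positivity) htot).trans ?_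
  have h1 : C₂ * a ≤ (B + C₂ + 1) * a := by gcongr; linarith
  have h2 : B * a ^ (p / 2) ≤ (B + C₂ + 1) * a ^ (p / 2) := by gcongr; linarith
  have := mul_le_mul_of_nonneg_left (add_le_add h1 h2) hε.le
  linarith

lemma setLIntegral_superlevel_le (hKpos : ∀ x, 0 < K x) {p s : ℝ} (hp : 0 ≤ p)
    (hs : 0 < s) {v : EN N → ℝ} (hv : Measurable v) :
    ∫⁻ x in {x | s ≤ |v x|}, ENNReal.ofReal (K x)
      ≤ ENNReal.ofReal (s ^ p)⁻¹ * ∫⁻ x, ENNReal.ofReal (K x * |v x| ^ p) := by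
  have hset : MeasurableSet {x | s ≤ |v x|} := measurableSet_le measurable_const hv.abs
  rw [← lintegral_const_mul' _ _ ENNReal.ofReal_ne_top]
  refine (setLIntegral_mono_ae' hset (Eventually.of_forall fun x hx => ?_)).trans
    (setLIntegral_le_lintegral _ _)
  have hK0 := (hKpos x).le
  rw [← ENNReal.ofReal_mul (by positivity)]
  apply ENNReal.ofReal_le_ofReal
  have h1 : s ^ p ≤ |v x| ^ p := Real.rpow_le_rpow hs.le hx hp
  calc K x = (s ^ p)⁻¹ * (K x * s ^ p) := by field_simp
    _ ≤ _ := by gcongr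

/-- The energy of the nontrivial functions satisfying the Nehari inequality is bounded from
below. -/
lemma exists_pos_le_normSq (hα : 0 < α) (hN : 2 * α < N) (hV : Continuous V)
    (hK : Continuous K) (h1 : H1 V K) (h3 : H3 V K) {f : ℝ → ℝ} (hf : Continuous f)
    (hf1 : Cf1 f) (hf2 : Cf2 f (critExp N α)) :
    ∃ ρ : ℝ, 0 < ρ ∧ ∀ v : EN N → ℝ, memX α V v → NotAEZero v → (∀ x, 0 ≤ v x) →
        normSq α V v ≤ ∫⁻ x, ENNReal.ofReal (K x * (|f (v x)| * v x)) →
        ρ ≤ (normSq α V v).toReal := by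
  obtain ⟨A, hA, hen⟩ := exists_energy_le hα hN hV hK h1 h3 hf hf1 hf2
  obtain ⟨B, hB, hLp⟩ := exists_lintegral_weight_rpow_le hα hN hV hK h1 h3
  have hp2 := two_lt_critExp hα hN
  set p := critExp N α with hp
  obtain ⟨C, s, hC, hs, hle⟩ := hen (1 / (2 * A)) (by positivity)
  set D : ℝ := 1 + 2 * C * ((s ^ p)⁻¹ * B) with hD
  have hD0 : 0 < D := by positivity
  refine ⟨D⁻¹ ^ (p / 2 - 1)⁻¹, by positivity, fun v hv hv0 hvn hv' => ?_⟩
  have ha := normSq_toReal_pos h1.1 hV hv hv0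
  have hks : ∫⁻ x in {x | s ≤ |v x|}, ENNReal.ofReal (K x)
      ≤ ENNReal.ofReal ((s ^ p)⁻¹ * (B * (normSq α V v).toReal ^ (p / 2))) := by
    refine (setLIntegral_superlevel_le h1.2.1 (p := p) (by linarith) hs hv.1).trans ?_
    rw [ENNReal.ofReal_mul (by positivity)]
    exact mul_le_mul_right (hLp v hv) _
  have h := hle v hv hvn hv' _ (by positivity) hks
  set a := (normSq α V v).toReal
  have h4 : 1 / (2 * A) * (A * a + A * a ^ (p / 2)) = (a + a ^ (p / 2)) / 2 := by
    field_simp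
  rw [h4] at h
  have h5 : a ≤ D * a ^ (p / 2) := by
    rw [hD]
    nlinarith
  have h6 : a ^ (p / 2) = a ^ (p / 2 - 1) * a := by
    rw [Real.rpow_sub_one ha.ne', div_mul_cancel₀ _ ha.ne']
  have h7 : D⁻¹ ≤ a ^ (p / 2 - 1) := by
    rw [inv_le_iff_one_le_mul₀' hD0]
    rw [h6, ← mul_assoc] at h5
    exact le_of_mul_le_mul_right (by linarith) ha
  have hq : 0 < p / 2 - 1 := by linarith
  calc D⁻¹ ^ (p / 2 - 1)⁻¹ ≤ (a ^ (p / 2 - 1)) ^ (p / 2 - 1)⁻¹ := by gcongr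
    _ = a := Real.rpow_rpow_inv ha.le hq.ne'

end Energy

section WeakLimit

variable {N : ℕ} {α : ℝ} {V K : EN N → ℝ}

lemma notAEZero_uplus_of_weakConv (hα : 0 < α) (hN : 2 * α < N) (hV : Continuous V)
    (hK : Continuous K) (h1 : H1 V K) (h2 : H2 K) (h3 : H3 V K) {f : ℝ → ℝ} (hf : Continuous f)
    (hf1 : Cf1 f) (hf2 : Cf2 f (critExp N α)) {u : ℕ → EN N → ℝ} (hu : ∀ n, memX α V (u n))
    (hne : ∀ n, NotAEZero (uplus (u n))) (hJ : ∀ n, Jd α V K f (u n) (uplus (u n)) = 0)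
    {R : ℝ} (hR : ∀ n, (normSq α V (u n)).toReal ≤ R) {w : EN N → ℝ} (hw : memX α V w)
    (hconv : weakConv α V u w) : NotAEZero (uplus w) := by
  intro hw0
  have hR0 : 0 ≤ R := ENNReal.toReal_nonneg.trans (hR 0)
  obtain ⟨ρ, hρ, hlow⟩ := exists_pos_le_normSq hα hN hV hK h1 h3 hf hf1 hf2
  obtain ⟨A, hA, hen⟩ := exists_energy_le hα hN hV hK h1 h3 hf hf1 hf2
  obtain ⟨C₁, hC₁⟩ := h1.2.2
  have hC₁0 : 0 ≤ C₁ := (h1.2.1 0).le.trans (hC₁ 0)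
  have hv : ∀ n, memX α V (uplus (u n)) := fun n => (hu n).uplus h1.1
  have hv0 : ∀ n x, 0 ≤ uplus (u n) x := fun n x => le_max_right _ _
  have hvR : ∀ n, (normSq α V (uplus (u n))).toReal ≤ R := fun n =>
    (ENNReal.toReal_mono (hu n).2.ne (normSq_uplus_le h1.1 _)).trans (hR n)
  have hNe : ∀ n, normSq α V (uplus (u n))
      ≤ ∫⁻ x, ENNReal.ofReal (K x * (|f (uplus (u n) x)| * uplus (u n) x)) := fun n =>
    normSq_uplus_le_lintegral hV h1.1 h1.2.1 (hu n) (hJ n)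
  have hp2 := two_lt_critExp hα hN
  set p := critExp N α with hp
  set E : ℝ := A * R + A * R ^ (p / 2) + 1 with hE
  have hE0 : 0 < E := by positivity
  obtain ⟨C, s, hC, hs, hle⟩ := hen (ρ / (4 * E)) (by positivity)
  set κ : ℝ := ρ / (4 * (C + 1)) with hκ
  have hκ0 : 0 < κ := by positivity
  obtain ⟨r, hr⟩ := exists_setLIntegral_superlevel_tail_le hα hN hV hK h1 h2 h3 hv hvR hs
    (half_pos hκ0)
  set z : ℕ → EN N → ℝ := fun n => u n + (-1 : ℝ) • w with hz
  have hzX : ∀ n, memX α V (z n) := fun n =>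
    (spaceX α hV h1.1).add_mem (hu n) ((spaceX α hV h1.1).smul_mem (-1) hw)
  have hzR : ∀ n, (normSq α V (z n)).toReal ≤ 2 * R + 2 * (normSq α V w).toReal := by
    intro n
    have h4 := normSq_add_le (α := α) hV h1.1 (v := (-1 : ℝ) • w) (hu n).1
    rw [normSq_smul, neg_one_sq, ENNReal.ofReal_one, one_mul] at h4
    have h5 := ENNReal.toReal_mono (ENNReal.add_ne_top.2
      ⟨ENNReal.mul_ne_top ENNReal.ofNat_ne_top (hu n).2.ne,
        ENNReal.mul_ne_top ENNReal.ofNat_ne_top hw.2.ne⟩) h4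
    rw [ENNReal.toReal_add (ENNReal.mul_ne_top ENNReal.ofNat_ne_top (hu n).2.ne)
      (ENNReal.mul_ne_top ENNReal.ofNat_ne_top hw.2.ne), ENNReal.toReal_mul, ENNReal.toReal_mul,
      ENNReal.toReal_ofNat] at h5
    linarith [hR n]
  have hzval : ∀ n x, z n x = u n x - w x := fun n x => by
    simp only [hz, Pi.add_apply, Pi.smul_apply, smul_eq_mul]
    ring
  have hzw : ∀ φ, memX α V φ → Tendsto (fun n => pairing α V (z n) φ) atTop (𝓝 0) := by
    intro φ hφ
    simpa only [pairing, hzval] using hconv φ hφ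
  have hvol := tendsto_volume_superlevel_inter_ball hα hV h1.1 hzX hzR hzw hs r
  have hvolK : Tendsto (fun n => ENNReal.ofReal C₁ * volume ({x | s ≤ |z n x|} ∩ Metric.ball 0 r))
      atTop (𝓝 0) := by
    simpa using ENNReal.Tendsto.const_mul hvol (Or.inr ENNReal.ofReal_ne_top)
  obtain ⟨n, hn⟩ := (ENNReal.tendsto_nhds_zero.1 hvolK (ENNReal.ofReal (κ / 2))
    (ENNReal.ofReal_pos.2 (half_pos hκ0))).exists
  have hsub : {x | s ≤ |uplus (u n) x|} ⊆ ({x | s ≤ |uplus (u n) x|} ∩ {x : EN N | r ≤ ‖x‖})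
      ∪ ({x | s ≤ |uplus (u n) x|} ∩ Metric.ball 0 r) := by
    intro x hx
    rcases le_or_gt r ‖x‖ with h | h
    · exact Or.inl ⟨hx, h⟩
    · exact Or.inr ⟨hx, mem_ball_zero_iff.2 h⟩
  have hball : ∫⁻ x in {x | s ≤ |uplus (u n) x|} ∩ Metric.ball 0 r, ENNReal.ofReal (K x)
      ≤ ENNReal.ofReal (κ / 2) := by
    refine le_trans ?_ hn
    calc ∫⁻ x in {x | s ≤ |uplus (u n) x|} ∩ Metric.ball 0 r, ENNReal.ofReal (K x)
        ≤ ∫⁻ _ in {x | s ≤ |uplus (u n) x|} ∩ Metric.ball 0 r, ENNReal.ofReal C₁ :=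
          lintegral_mono fun x => ENNReal.ofReal_le_ofReal (hC₁ x)
      _ = ENNReal.ofReal C₁ * volume ({x | s ≤ |uplus (u n) x|} ∩ Metric.ball 0 r) :=
          setLIntegral_const _ _
      _ ≤ _ := by
          refine mul_le_mul_right (measure_mono_ae ?_) _
          filter_upwards [hw0] with x hx hxs
          refine ⟨?_, hxs.2⟩
          have h4 : w x ≤ 0 := max_eq_right_iff.1 hx
          have h5 : s ≤ |max (u n x) 0| := hxs.1
          show s ≤ |z n x|
          rw [hzval]
          rcases le_total (u n x) 0 with h | h
          · rw [max_eq_right h, abs_zero] at h5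
            linarith
          · rw [max_eq_left h, abs_of_nonneg h] at h5
            exact (by linarith : s ≤ u n x - w x).trans (le_abs_self _)
  have hk : ∫⁻ x in {x | s ≤ |uplus (u n) x|}, ENNReal.ofReal (K x) ≤ ENNReal.ofReal κ := by
    refine (lintegral_mono_set hsub).trans ((lintegral_union_le _ _ _).trans ?_)
    refine (add_le_add (hr n) hball).trans (le_of_eq ?_)
    rw [← ENNReal.ofReal_add (by positivity) (by positivity), add_halves]
  have hfin := hle _ (hv n) (hv0 n) (hNe n) κ hκ0.le hk
  have hlo := hlow _ (hv n) (hne n) (hv0 n) (hNe n)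
  have ha0 : 0 ≤ (normSq α V (uplus (u n))).toReal := ENNReal.toReal_nonneg
  have haR := hvR n
  set a := (normSq α V (uplus (u n))).toReal
  have h6 : A * a + A * a ^ (p / 2) ≤ E := by
    have : A * a + A * a ^ (p / 2) ≤ A * R + A * R ^ (p / 2) := by gcongr
    linarith
  have h7 : ρ / (4 * E) * (A * a + A * a ^ (p / 2)) ≤ ρ / 4 := by
    calc ρ / (4 * E) * (A * a + A * a ^ (p / 2)) ≤ ρ / (4 * E) * E := by gcongr
      _ = ρ / 4 := by field_simp
  have h8 : C * κ ≤ ρ / 4 := by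
    calc C * κ ≤ (C + 1) * κ := by gcongr; linarith
      _ = ρ / 4 := by rw [hκ]; field_simp
  linarith

end WeakLimit

section Reflection

variable {N : ℕ} {α : ℝ} {V K : EN N → ℝ}

lemma Cf1.neg_comp_neg {f : ℝ → ℝ} (hf : Cf1 f) : Cf1 fun t => -f (-t) := by
  have h0 : Tendsto (fun t : ℝ => -t) (𝓝[≠] 0) (𝓝[≠] 0) := by
    refine tendsto_nhdsWithin_iff.2 ⟨?_, ?_⟩
    · simpa using (tendsto_neg (0 : ℝ)).mono_left nhdsWithin_le_nhds
    · filter_upwards [self_mem_nhdsWithin] with t ht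
      simpa using ht
  have h := (Tendsto.comp hf h0).neg
  simpa [Cf1, Function.comp_def, neg_div] using h

lemma Cf2.neg_comp_neg {f : ℝ → ℝ} {p : ℝ} (hf : Cf2 f p) : Cf2 (fun t => -f (-t)) p := by
  have h0 : Tendsto (fun t : ℝ => -t) (comap (fun t : ℝ => |t|) atTop)
      (comap (fun t : ℝ => |t|) atTop) := by
    rw [tendsto_comap_iff]
    simpa only [Function.comp_def, abs_neg] using tendsto_comap (f := fun t : ℝ => |t|)
  have h := (Tendsto.comp hf h0).neg
  simpa [Cf2, Function.comp_def, neg_div] using h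

lemma uplus_neg (u : EN N → ℝ) : uplus (-u) = -uminus u := by
  funext x
  simp only [uplus, uminus, Pi.neg_apply]
  rw [← neg_zero, max_neg_neg, neg_zero]

lemma notAEZero_neg {u : EN N → ℝ} : NotAEZero (-u) ↔ NotAEZero u := by
  refine not_congr ⟨fun h => ?_, fun h => ?_⟩ <;> filter_upwards [h] with x hx <;> simpa using hx

lemma normSq_neg (u : EN N → ℝ) : normSq α V (-u) = normSq α V u := by
  have := normSq_smul (α := α) (V := V) (-1) u
  simpa using this

lemma memX.neg {u : EN N → ℝ} (hu : memX α V u) : memX α V (-u) :=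
  ⟨hu.1.neg, by rw [normSq_neg]; exact hu.2⟩

lemma Jd_neg (f : ℝ → ℝ) (u φ : EN N → ℝ) :
    Jd α V K (fun t => -f (-t)) (-u) (-φ) = Jd α V K f u φ := by
  unfold Jd
  congr 1
  · congr 1 <;> refine integral_congr_ae (Eventually.of_forall fun p => ?_) <;>
      simp only [Pi.neg_apply] <;> ring
  · refine integral_congr_ae (Eventually.of_forall fun p => ?_)
    simp only [Pi.neg_apply, neg_neg]
    ring

lemma weakConv.neg {u : ℕ → EN N → ℝ} {w : EN N → ℝ} (h : weakConv α V u w) :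
    weakConv α V (fun n => -u n) (-w) := by
  intro v hv
  convert h (-v) hv.neg using 2 with n
  congr 1 <;> refine integral_congr_ae (Eventually.of_forall fun p => ?_) <;>
    simp only [Pi.neg_apply] <;> ring

end Reflection

end ZeroMass

open ZeroMass
/-- Lemma 4.2: if a bounded sequence in `M` converges weakly in `X` to `u`, then
`u⁺ ≠ 0` and `u⁻ ≠ 0`. -/
theorem statement19 {N : ℕ} (α : ℝ) (hα : α ∈ Set.Ioo (0 : ℝ) 1) (hN : 2 * α < N)
    (V K : EN N → ℝ) (f : ℝ → ℝ)
    (hV : Continuous V) (hK : Continuous K) (hf : Continuous f)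
    (h1 : H1 V K) (h2 : H2 K) (h3 : H3 V K)
    (hf1 : Cf1 f) (hf2 : Cf2 f (critExp N α)) (hf3 : Cf3 f) (hf4 : Cf4 f)
    (u : ℕ → EN N → ℝ) (hu : ∀ n, memM α V K f (u n))
    (hbdd : ∃ C : ℝ, ∀ n, Xnorm α V (u n) ≤ C)
    (w : EN N → ℝ) (hw : memX α V w) (hconv : weakConv α V u w) :
    NotAEZero (uplus w) ∧ NotAEZero (uminus w) := by
  obtain ⟨C, hC⟩ := hbdd
  have hX : ∀ n, memX α V (u n) := fun n => (hu n).1.1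
  have hR : ∀ n, (normSq α V (u n)).toReal ≤ C ^ 2 := by
    intro n
    have h0 : 0 ≤ (normSq α V (u n)).toReal := ENNReal.toReal_nonneg
    have h := hC n
    rw [Xnorm, ← Real.sqrt_eq_rpow] at h
    exact (Real.sqrt_le_left ((Real.sqrt_nonneg _).trans h)).1 h
  refine ⟨notAEZero_uplus_of_weakConv hα.1 hN hV hK h1 h2 h3 hf hf1 hf2 hX
    (fun n => (hu n).2.1) (fun n => (hu n).2.2.2.1) hR hw hconv, ?_⟩
  have h := notAEZero_uplus_of_weakConv (u := fun n => -u n) (w := -w) hα.1 hN hV hK h1 h2 h3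
    (hf.comp continuous_neg).neg hf1.neg_comp_neg hf2.neg_comp_neg (fun n => (hX n).neg)
    (fun n => by rw [uplus_neg, notAEZero_neg]; exact (hu n).2.2.1)
    (fun n => by
      rw [uplus_neg]
      exact (Jd_neg f (u n) (uminus (u n))).trans (hu n).2.2.2.2)
    (fun n => by rw [normSq_neg]; exact hR n) hw.neg hconv.neg
  rwa [uplus_neg, notAEZero_neg] at h
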